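/- Consider the planar system ẋ = −φ(y) − F(x), ẏ = g(x), where: (1) g is Lipschitz continuous on every bounded interval, x g(x) > 0 for all x ≠ 0, and G(x) = ∫₀ˣ g(s) ds has the same (possibly infinite) limit as x → +∞ and as x → −∞; (2) F is C¹ with F(0) = 0 and f = F′ continuous on ℝ, the quotient f(x)/g(x) is non-increasing on (−∞, 0) and on (0, +∞), and f(x)/g(x) is non-constant on every punctured neighborhood of 0; (3) φ is Lipschitz continuous on every bounded interval, y φ(y) > 0 for all y ≠ 0, φ is non-decreasing, and φ has one-sided derivatives φ′₊(0) and φ′₋(0) at 0 with φ′₊(0)·φ′₋(0) ≠ 0 whenever f(0) = 0. Then the system has at most one limit cycle, i.e. any two limit cycles coincide as subsets of ℝ². -/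

import Mathlib

open Filter

/-- `(x, y)` is a solution of the planar system `ẋ = -φ(y) - F(x)`, `ẏ = g(x)`. -/
def IsSolGenLienard (φ F g : ℝ → ℝ) (x y : ℝ → ℝ) : Prop :=
  ∀ t : ℝ, HasDerivAt x (-φ (y t) - F (x t)) t ∧ HasDerivAt y (g (x t)) t

/-- `Γ` is a periodic orbit of the system `ẋ = -φ(y) - F(x)`, `ẏ = g(x)`:
the image in `ℝ²` of a nonconstant periodic solution. -/
def IsPeriodicOrbitGenLienard (φ F g : ℝ → ℝ) (Γ : Set (ℝ × ℝ)) : Prop :=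
  ∃ x y : ℝ → ℝ, IsSolGenLienard φ F g x y ∧
    (∃ t₁ t₂ : ℝ, (x t₁, y t₁) ≠ (x t₂, y t₂)) ∧
    (∃ T : ℝ, 0 < T ∧ ∀ t : ℝ, (x (t + T), y (t + T)) = (x t, y t)) ∧
    Γ = Set.range (fun t : ℝ => (x t, y t))

/-- `Γ` is a limit cycle of the system `ẋ = -φ(y) - F(x)`, `ẏ = g(x)`: a periodic
orbit having an open neighborhood `U` in which it is the only periodic orbit. -/
def IsLimitCycleGenLienard (φ F g : ℝ → ℝ) (Γ : Set (ℝ × ℝ)) : Prop :=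
  IsPeriodicOrbitGenLienard φ F g Γ ∧
  ∃ U : Set (ℝ × ℝ), IsOpen U ∧ Γ ⊆ U ∧
    ∀ Γ' : Set (ℝ × ℝ), IsPeriodicOrbitGenLienard φ F g Γ' → Γ' ⊆ U → Γ' = Γ

namespace LCU

open Set



lemma gron_fwd {w : ℝ → ℝ} {a b K : ℝ} (hab : a ≤ b) (hw : ContinuousOn w (Icc a b))
    (h0 : w a ≤ 0)
    (hd : ∀ y ∈ Ioo a b, 0 < w y → ∃ w', HasDerivAt w w' y ∧ w' ≤ K * w y) : w b ≤ 0 := by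
  by_contra hwb
  push Not at hwb
  have hS : IsCompact (Icc a b ∩ w ⁻¹' Iic 0) :=
    isCompact_Icc.of_isClosed_subset
      (hw.preimage_isClosed_of_isClosed isClosed_Icc isClosed_Iic) inter_subset_left
  obtain ⟨a', ha', hmax⟩ := hS.exists_isGreatest ⟨a, ⟨le_refl _, hab⟩, h0⟩
  have hpos : ∀ y, a' < y → y ≤ b → 0 < w y := by
    intro y h1 h2
    by_contra h3
    push Not at h3
    have := hmax ⟨⟨ha'.1.1.trans h1.le, h2⟩, h3⟩
    linarith
  have hanti : AntitoneOn (fun y => Real.exp (-K * y) * w y) (Icc a' b) := by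
    have hder : ∀ y ∈ Ioo a' b, ∃ w', HasDerivAt w w' y ∧ w' ≤ K * w y := fun y hy =>
      hd y ⟨ha'.1.1.trans_lt hy.1, hy.2⟩ (hpos y hy.1 hy.2.le)
    have hder2 : ∀ y w', HasDerivAt w w' y → HasDerivAt (fun y => Real.exp (-K * y) * w y)
        (Real.exp (-K * y) * (-K) * w y + Real.exp (-K * y) * w') y := by
      intro y w' h
      have h1 : HasDerivAt (fun y => Real.exp (-K * y)) (Real.exp (-K * y) * (-K)) y := by
        have := ((hasDerivAt_id y).const_mul (-K)).exp
        simpa using this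
      exact h1.mul h
    apply antitoneOn_of_deriv_nonpos (convex_Icc a' b)
    · apply ContinuousOn.mul
      · fun_prop
      · exact hw.mono (Icc_subset_Icc ha'.1.1 le_rfl)
    · rw [interior_Icc]
      intro y hy
      obtain ⟨w', h1, _⟩ := hder y hy
      exact (hder2 y w' h1).differentiableAt.differentiableWithinAt
    · rw [interior_Icc]
      intro y hy
      obtain ⟨w', h1, h2⟩ := hder y hy
      rw [(hder2 y w' h1).deriv]
      have : 0 < Real.exp (-K * y) := Real.exp_pos _
      nlinarith
  have h1 := hanti ⟨le_refl _, ha'.1.2⟩ ⟨ha'.1.2, le_refl _⟩ ha'.1.2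
  have h2 : w a' ≤ 0 := ha'.2
  have h3 : 0 < Real.exp (-K * b) * w b := mul_pos (Real.exp_pos _) hwb
  have h4 : Real.exp (-K * a') * w a' ≤ 0 :=
    mul_nonpos_of_nonneg_of_nonpos (Real.exp_pos _).le h2
  simp only at h1
  linarith

lemma hasDerivAt_comp_neg' {w : ℝ → ℝ} {w' y : ℝ} (h : HasDerivAt w w' (-y)) :
    HasDerivAt (fun s => w (-s)) (-w') y := by
  have := HasDerivAt.comp y h (hasDerivAt_neg y)
  exact this.congr_deriv (by ring)

lemma continuousOn_comp_neg {w : ℝ → ℝ} {a b : ℝ} (h : ContinuousOn w (Icc a b)) :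
    ContinuousOn (fun s => w (-s)) (Icc (-b) (-a)) := by
  refine h.comp continuous_neg.continuousOn ?_
  intro y hy
  exact ⟨by linarith [hy.2], by linarith [hy.1]⟩

lemma gron_bwd {w : ℝ → ℝ} {a b K : ℝ} (hab : a ≤ b) (hw : ContinuousOn w (Icc a b))
    (h0 : w b ≤ 0)
    (hd : ∀ y ∈ Ioo a b, 0 < w y → ∃ w', HasDerivAt w w' y ∧ -K * w y ≤ w') : w a ≤ 0 := by
  have := gron_fwd (w := fun s => w (-s)) (a := -b) (b := -a) (K := K) (by linarith)
    (continuousOn_comp_neg hw) (by simpa using h0) (by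
      intro y hy hpos
      obtain ⟨w', h1, h2⟩ := hd (-y) ⟨by linarith [hy.2], by linarith [hy.1]⟩ hpos
      exact ⟨-w', hasDerivAt_comp_neg' h1, by linarith⟩)
  simpa using this

lemma hasDerivAt_exp_mul {w : ℝ → ℝ} {w' y : ℝ} (K : ℝ) (h : HasDerivAt w w' y) :
    HasDerivAt (fun y => Real.exp (K * y) * w y)
        (Real.exp (K * y) * (K * w y + w')) y := by
  have h1 : HasDerivAt (fun y => Real.exp (K * y)) (Real.exp (K * y) * K) y := by
    have := ((hasDerivAt_id y).const_mul K).exp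
    simpa using this
  exact (h1.mul h).congr_deriv (by ring)

/-- if `v' ≥ -K v` then `exp (K y) v` is monotone -/
lemma exp_mono {v d : ℝ → ℝ} {b t K : ℝ} (hv : ContinuousOn v (Icc b t))
    (hd : ∀ y ∈ Ioo b t, HasDerivAt v (d y) y) (hge : ∀ y ∈ Ioo b t, -K * v y ≤ d y) :
    MonotoneOn (fun y => Real.exp (K * y) * v y) (Icc b t) := by
  apply monotoneOn_of_deriv_nonneg (convex_Icc b t)
  · apply ContinuousOn.mul
    · fun_prop
    · exact hv
  · rw [interior_Icc]
    intro y hy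
    exact (hasDerivAt_exp_mul K (hd y hy)).differentiableAt.differentiableWithinAt
  · rw [interior_Icc]
    intro y hy
    rw [(hasDerivAt_exp_mul K (hd y hy)).deriv]
    have : 0 < Real.exp (K * y) := Real.exp_pos _
    have := hge y hy
    apply mul_nonneg (by positivity)
    linarith

lemma no_return {v d : ℝ → ℝ} {b t K : ℝ} (hv : ContinuousOn v (Icc b t))
    (hvb : v b = 0) (hvt : v t = 0)
    (hd : ∀ y ∈ Ioo b t, HasDerivAt v (d y) y) (hge : ∀ y ∈ Ioo b t, -K * v y ≤ d y)
    {y0 : ℝ} (hy0 : y0 ∈ Ioo b t) (hlt : -K * v y0 < d y0) : False := by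
  have hm := exp_mono hv hd hge
  have hz : ∀ y ∈ Icc b t, v y = 0 := by
    intro y hy
    have h1 := hm ⟨le_refl _, hy.1.trans hy.2⟩ hy hy.1
    have h2 := hm hy ⟨hy.1.trans hy.2, le_refl _⟩ hy.2
    simp only [hvb, hvt, mul_zero] at h1 h2
    have h3 : Real.exp (K * y) * v y = 0 := le_antisymm h2 h1
    rcases mul_eq_zero.1 h3 with h | h
    · exact absurd h (Real.exp_pos _).ne'
    · exact h
  have h0 : HasDerivAt v 0 y0 := by
    have : v =ᶠ[nhds y0] fun _ => 0 := by
      filter_upwards [Icc_mem_nhds hy0.1 hy0.2] with y hy using hz y hy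
    exact (hasDerivAt_const y0 (0:ℝ)).congr_of_eventuallyEq this
  have h4 := (hd y0 hy0).unique h0
  rw [h4, hz y0 (Ioo_subset_Icc_self hy0)] at hlt
  simp at hlt

def SlopeLe (F : ℝ → ℝ) (m K : ℝ) : Prop :=
  ∀ p q, 0 ≤ p → p ≤ q → q ≤ m → F q - F p ≤ K * (q - p)

/-- lower slope bound from `v` upwards, as long as `v > 0` -/
def LowSlope (F : ℝ → ℝ) (m : ℝ) : Prop :=
  ∀ v, 0 < v → ∃ K, ∀ p, v ≤ p → p ≤ m → F v - F p ≤ K * (p - v)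

lemma slopeLe_of_convex {F : ℝ → ℝ} {m M : ℝ} (hm : 0 < m) (hmM : m < M)
    (hF : ConvexOn ℝ (Icc 0 M) F) : ∃ K, SlopeLe F m K := by
  refine ⟨(F M - F m) / (M - m), ?_⟩
  intro p q hp hpq hq
  rcases hpq.eq_or_lt with rfl | hpq
  · simp
  have h1 : (F q - F p) / (q - p) ≤ (F M - F m) / (M - m) := by
    have hMem : M ∈ Icc (0:ℝ) M := ⟨by linarith, le_refl _⟩
    have hpMem : p ∈ Icc (0:ℝ) M := ⟨hp, by linarith⟩
    have a1 := hF.slope_mono_adjacent hpMem hMem hpq (by linarith)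
    rcases hq.eq_or_lt with rfl | hq
    · exact a1
    have a2 := hF.slope_mono_adjacent (x := q) (y := m) (z := M)
      ⟨by linarith, by linarith⟩ hMem hq hmM
    have a3 := hF.slope_mono_adjacent (x := p) (y := q) (z := m)
      hpMem ⟨by linarith, by linarith⟩ hpq hq
    exact a3.trans a2
  rw [div_le_iff₀ (by linarith)] at h1
  exact h1

lemma lowSlope_of_convex {F : ℝ → ℝ} {m M : ℝ} (hmM : m < M)
    (hF : ConvexOn ℝ (Icc 0 M) F) : LowSlope F m := by
  intro v hv
  refine ⟨-((F v - F 0) / (v - 0)), ?_⟩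
  intro p hp hpm
  rcases hp.eq_or_lt with rfl | hp
  · simp
  have a := hF.slope_mono_adjacent (x := 0) (y := v) (z := p)
      ⟨le_refl _, by linarith⟩ ⟨by linarith, by linarith⟩ hv hp
  rw [le_div_iff₀ (by linarith)] at a
  linarith

lemma lowSlope_neg {F : ℝ → ℝ} {m K : ℝ} (h : SlopeLe F m K) : LowSlope (fun ζ => -F ζ) m := by
  intro v hv
  refine ⟨K, fun p hp hpm => ?_⟩
  have := h v p hv.le hp hpm
  simp only
  linarith

/-- an arc of the scalar equation `dz/dy = -φ(y) - F(z)` -/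
structure Arc (φ F : ℝ → ℝ) (m b t : ℝ) (z : ℝ → ℝ) : Prop where
  hb : b < 0
  ht : 0 < t
  cont : ContinuousOn z (Icc b t)
  zb : z b = 0
  zt : z t = 0
  pos : ∀ y ∈ Ioo b t, 0 < z y
  le : ∀ y ∈ Icc b t, z y ≤ m
  der : ∀ y ∈ Ioo b t, HasDerivAt z (-φ y - F (z y)) y

lemma Arc.nonneg {φ F : ℝ → ℝ} {m b t : ℝ} {z : ℝ → ℝ} (h : Arc φ F m b t z) :
    ∀ y ∈ Icc b t, 0 ≤ z y := by
  intro y hy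
  rcases hy.1.eq_or_lt with rfl | h1
  · exact h.zb.ge
  rcases hy.2.eq_or_lt with rfl | h2
  · exact h.zt.ge
  exact (h.pos y ⟨h1, h2⟩).le

lemma Arc.mirror {φ F : ℝ → ℝ} {m b t : ℝ} {z : ℝ → ℝ} (h : Arc φ F m b t z) :
    Arc (fun y => -φ (-y)) (fun ζ => -F ζ) m (-t) (-b) (fun y => z (-y)) where
  hb := by linarith [h.ht]
  ht := by linarith [h.hb]
  cont := continuousOn_comp_neg h.cont
  zb := by simpa using h.zt
  zt := by simpa using h.zb
  pos := fun y hy => h.pos (-y) ⟨by linarith [hy.2], by linarith [hy.1]⟩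
  le := fun y hy => h.le (-y) ⟨by linarith [hy.2], by linarith [hy.1]⟩
  der := fun y hy => by
    have := hasDerivAt_comp_neg' (h.der (-y) ⟨by linarith [hy.2], by linarith [hy.1]⟩)
    exact this.congr_deriv (by ring)

lemma Arc.nc {φ F : ℝ → ℝ} {m b t b' t' K : ℝ} {z Z : ℝ → ℝ} (hz : Arc φ F m b t z)
    (hZ : Arc φ F m b' t' Z) (hK : SlopeLe F m K) (hbb : b' < b) :
    t < t' ∧ ∀ y ∈ Icc b t, z y < Z y := by
  have key : ∀ y, b ≤ y → y ≤ t → y ≤ t' → z y < Z y := by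
    intro y h1 h2 h3
    by_contra hlt
    push Not at hlt
    have := gron_bwd (w := fun s => Z s - z s) (a := b) (b := y) (K := K) h1
      ((hZ.cont.mono (Icc_subset_Icc hbb.le h3)).sub (hz.cont.mono (Icc_subset_Icc le_rfl h2)))
      (by linarith) (by
        intro s hs hpos
        have hs1 : s ∈ Ioo b t := ⟨hs.1, hs.2.trans_le h2⟩
        have hs2 : s ∈ Ioo b' t' := ⟨hbb.trans hs.1, hs.2.trans_le h3⟩
        refine ⟨_, (hZ.der s hs2).sub (hz.der s hs1), ?_⟩
        have := hK (z s) (Z s) (hz.pos s hs1).le (by linarith)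
          (hZ.le s (Ioo_subset_Icc_self hs2))
        linarith)
    have hp := hZ.pos b ⟨hbb, hz.hb.trans hZ.ht⟩
    simp only [hz.zb] at this
    linarith
  have htt : t < t' := by
    by_contra h
    push Not at h
    have h1 := key t' (hz.hb.trans hZ.ht).le h le_rfl
    have h2 := hz.nonneg t' ⟨(hz.hb.trans hZ.ht).le, h⟩
    rw [hZ.zt] at h1
    linarith
  exact ⟨htt, fun y hy => key y hy.1 hy.2 (hy.2.trans htt.le)⟩

lemma Arc.nc' {φ F : ℝ → ℝ} {m b t b' t' K : ℝ} {z Z : ℝ → ℝ} (hz : Arc φ F m b t z)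
    (hZ : Arc φ F m b' t' Z) (hK : SlopeLe (fun ζ => -F ζ) m K) (htt : t < t') :
    b' < b ∧ ∀ y ∈ Icc b t, z y < Z y := by
  obtain ⟨h1, h2⟩ := hz.mirror.nc hZ.mirror hK (by linarith)
  refine ⟨by linarith, fun y hy => ?_⟩
  have := h2 (-y) ⟨by linarith [hy.2], by linarith [hy.1]⟩
  simpa using this

lemma Arc.no_rise {φ F : ℝ → ℝ} {m b t : ℝ} {z : ℝ → ℝ} (hz : Arc φ F m b t z)
    (hφ : Monotone φ) (hF : LowSlope F m) {ys : ℝ} (hys : ys ∈ Ioo b t)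
    (hneg : -φ ys - F (z ys) ≤ 0) : ∀ y ∈ Icc ys t, z y ≤ z ys := by
  intro y hy
  obtain ⟨K, hK⟩ := hF (z ys) (hz.pos ys hys)
  have := gron_fwd (w := fun s => z s - z ys) (a := ys) (b := y) (K := K) hy.1
    ((hz.cont.mono (Icc_subset_Icc hys.1.le hy.2)).sub continuousOn_const)
    (by simp) (by
      intro s hs hpos
      have hs1 : s ∈ Ioo b t := ⟨hys.1.trans hs.1, hs.2.trans_le hy.2⟩
      refine ⟨_, (hz.der s hs1).sub_const _, ?_⟩
      have := hK (z s) (by linarith) (hz.le s (Ioo_subset_Icc_self hs1))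
      have h2 := hφ hs.1.le
      linarith)
  linarith

lemma Arc.no_rise' {φ F : ℝ → ℝ} {m b t : ℝ} {z : ℝ → ℝ} (hz : Arc φ F m b t z)
    (hφ : Monotone φ) (hF : LowSlope (fun ζ => -F ζ) m) {ys : ℝ} (hys : ys ∈ Ioo b t)
    (hneg : 0 ≤ -φ ys - F (z ys)) : ∀ y ∈ Icc b ys, z y ≤ z ys := by
  intro y hy
  have hφ' : Monotone (fun y => -φ (-y)) := fun a b hab => by
    have := hφ (neg_le_neg hab)
    simp only; linarith
  have := hz.mirror.no_rise hφ' hF (ys := -ys) ⟨by linarith [hys.2], by linarith [hys.1]⟩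
    (by simp only [neg_neg]; linarith) (-y) ⟨by linarith [hy.2], by linarith [hy.1]⟩
  simpa using this

/-- upper decomposition -/
lemma Arc.decomp_up {φ F : ℝ → ℝ} {m b t z0 yM : ℝ} {z : ℝ → ℝ} (hz : Arc φ F m b t z)
    (hφ : Monotone φ) (hF : LowSlope F m) (hF' : LowSlope (fun ζ => -F ζ) m)
    (h0 : 0 < z0) (hyM : yM ∈ Ioo b t) (hM : z0 < z yM) :
    ∃ e, yM < e ∧ e < t ∧ z e = z0 ∧ (∀ y, yM ≤ y → y < e → z0 < z y) ∧
      (∀ y, e ≤ y → y < t → 0 < φ y + F (z y)) ∧ StrictAntiOn z (Icc e t) := by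
  have hneg : ∀ y, yM ≤ y → y < t → z y ≤ z0 → 0 < φ y + F (z y) := by
    intro y h1 h2 h3
    by_contra h4
    have := hz.no_rise' hφ hF' (ys := y) ⟨hyM.1.trans_le h1, h2⟩ (by linarith) yM
      ⟨hyM.1.le, h1⟩
    linarith
  have hc : ContinuousOn z (Icc yM t) := hz.cont.mono (Icc_subset_Icc hyM.1.le le_rfl)
  have hS : IsCompact (Icc yM t ∩ z ⁻¹' Ici z0) :=
    isCompact_Icc.of_isClosed_subset
      (hc.preimage_isClosed_of_isClosed isClosed_Icc isClosed_Ici) inter_subset_left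
  obtain ⟨e, he, hmax⟩ := hS.exists_isGreatest ⟨yM, ⟨le_refl _, hyM.2.le⟩, hM.le⟩
  have hez : z0 ≤ z e := he.2
  have het : e < t := by
    rcases he.1.2.eq_or_lt with h | h
    · rw [h, hz.zt] at hez; linarith
    · exact h
  have hlt : ∀ y, e < y → y ≤ t → z y < z0 := by
    intro y h1 h2
    by_contra h3
    push Not at h3
    have := hmax ⟨⟨he.1.1.trans h1.le, h2⟩, h3⟩
    linarith
  have hee : z e = z0 := by
    apply le_antisymm _ hez
    by_contra h
    push Not at h
    obtain ⟨y, hy1, hy2⟩ := intermediate_value_Icc' het.le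
      (hc.mono (Icc_subset_Icc he.1.1 le_rfl)) (show (z0 + z e)/2 ∈ Icc (z t) (z e) from
        ⟨by rw [hz.zt]; linarith, by linarith⟩)
    rcases hy1.1.eq_or_lt with h5 | h5
    · rw [← h5] at hy2; linarith
    · have := hlt y h5 hy1.2
      linarith
  have hMe : yM < e := by
    rcases he.1.1.eq_or_lt with h | h
    · rw [h, hee] at hM; linarith
    · exact h
  have hge : ∀ y, e ≤ y → y < t → z y ≤ z0 := by
    intro y h1 h2
    rcases h1.eq_or_lt with rfl | h1
    · exact hee.le
    · exact (hlt y h1 h2.le).le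
  refine ⟨e, hMe, het, hee, ?_, ?_, ?_⟩
  · intro y h1 h2
    by_contra h3
    push Not at h3
    have hd := hneg y h1 (h2.trans het) h3
    have hyI : y ∈ Ioo b t := ⟨hyM.1.trans_le h1, h2.trans het⟩
    have hno := hz.no_rise hφ hF hyI (by linarith)
    have h4 := hno e ⟨h2.le, het.le⟩
    have hyz : z y = z0 := le_antisymm h3 (by linarith)
    -- z is then ≤ z0 on [y, e], while its derivative at e is negative
    have hde := hneg e he.1.1 het hee.le
    have heI : e ∈ Ioo b t := ⟨hyI.1.trans h2, het⟩
    have hall : ∀ s ∈ Icc y e, z s = z0 := by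
      intro s hs
      apply le_antisymm
      · have := hno s ⟨hs.1, hs.2.trans het.le⟩
        linarith
      · by_contra h6
        push Not at h6
        have hsI : s ∈ Ioo b t := ⟨hyI.1.trans_le hs.1, hs.2.trans_lt het⟩
        have hds := hneg s (h1.trans hs.1) hsI.2 h6.le
        have := hz.no_rise hφ hF hsI (by linarith) e ⟨hs.2, het.le⟩
        linarith
    obtain ⟨s, hs, hs2⟩ := exists_hasDerivAt_eq_slope z (fun s => -φ s - F (z s)) h2
      (hz.cont.mono (Icc_subset_Icc hyI.1.le het.le))
      (fun s hs => hz.der s ⟨hyI.1.trans hs.1, hs.2.trans het⟩)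
    rw [hee, hyz, sub_self, zero_div] at hs2
    have := hneg s (h1.trans hs.1.le) (hs.2.trans het) (hall s (Ioo_subset_Icc_self hs)).le
    linarith
  · intro y h1 h2
    exact hneg y (hMe.le.trans h1) h2 (hge y h1 h2)
  · apply strictAntiOn_of_deriv_neg (convex_Icc e t)
    · exact hc.mono (Icc_subset_Icc hMe.le le_rfl)
    · rw [interior_Icc]
      intro y hy
      have hyI : y ∈ Ioo b t := ⟨hyM.1.trans (hMe.trans hy.1), hy.2⟩
      rw [(hz.der y hyI).deriv]
      have := hneg y (hMe.trans hy.1).le hy.2 (hge y hy.1.le hy.2)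
      linarith



/-- auxiliary function: `κ(ys)=0`, `κ' = φ + c z0 - c κ` -/
structure Kap (φ : ℝ → ℝ) (c z0 ys : ℝ) (κ : ℝ → ℝ) : Prop where
  base : φ ys = -c * z0
  zero : κ ys = 0
  der : ∀ y, HasDerivAt κ (φ y + c * z0 - c * κ y) y

lemma Kap.exists {φ : ℝ → ℝ} {c z0 ys : ℝ} (hφ : Continuous φ) (h : φ ys = -c * z0) :
    ∃ κ, Kap φ c z0 ys κ := by
  refine ⟨fun y => Real.exp (-c * y) * ∫ s in ys..y, Real.exp (c * s) * (φ s + c * z0),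
    h, by simp, fun y => ?_⟩
  have hc : Continuous (fun s => Real.exp (c * s) * (φ s + c * z0)) := by fun_prop
  have h1 : HasDerivAt (fun y => ∫ s in ys..y, Real.exp (c * s) * (φ s + c * z0))
      (Real.exp (c * y) * (φ y + c * z0)) y :=
    intervalIntegral.integral_hasDerivAt_right (hc.intervalIntegrable _ _)
      (hc.stronglyMeasurableAtFilter _ _) hc.continuousAt
  refine (hasDerivAt_exp_mul (-c) h1).congr_deriv ?_
  have : Real.exp (-c * y) * Real.exp (c * y) = 1 := by
    rw [← Real.exp_add]; simp
  linear_combination (φ y + c * z0) * this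

lemma Kap.cont {φ κ : ℝ → ℝ} {c z0 ys : ℝ} (h : Kap φ c z0 ys κ) : Continuous κ :=
  continuous_iff_continuousAt.2 fun y => (h.der y).continuousAt

lemma mono_mirror {φ : ℝ → ℝ} (hφ : Monotone φ) : Monotone (fun y => -φ (-y)) :=
  fun a b hab => by
    have := hφ (neg_le_neg hab)
    simp only; linarith

lemma Kap.mirror {φ κ : ℝ → ℝ} {c z0 ys : ℝ} (h : Kap φ c z0 ys κ) :
    Kap (fun y => -φ (-y)) (-c) z0 (-ys) (fun y => κ (-y)) where
  base := by simp only [neg_neg]; linarith [h.base]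
  zero := by simpa using h.zero
  der := fun y => (hasDerivAt_comp_neg' (h.der (-y))).congr_deriv (by ring)

lemma Kap.psi_nonneg {φ κ : ℝ → ℝ} {c z0 ys : ℝ} (h : Kap φ c z0 ys κ) (hφ : Monotone φ)
    {y : ℝ} (hy : ys ≤ y) : 0 ≤ φ y + c * z0 := by
  have := hφ hy
  rw [h.base] at this
  linarith

lemma Kap.nonneg_up {φ κ : ℝ → ℝ} {c z0 ys : ℝ} (h : Kap φ c z0 ys κ) (hφ : Monotone φ)
    {y : ℝ} (hy : ys ≤ y) : 0 ≤ κ y := by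
  have hm := exp_mono (v := κ) (b := ys) (t := y) (K := c) h.cont.continuousOn
    (fun s _ => h.der s) (fun s hs => by
      have := h.psi_nonneg hφ hs.1.le
      linarith)
  have := hm ⟨le_refl _, hy⟩ ⟨hy, le_refl _⟩ hy
  simp only [h.zero, mul_zero] at this
  exact nonneg_of_mul_nonneg_right this (Real.exp_pos _)

lemma Kap.nonneg {φ κ : ℝ → ℝ} {c z0 ys : ℝ} (h : Kap φ c z0 ys κ) (hφ : Monotone φ)
    (y : ℝ) : 0 ≤ κ y := by
  rcases le_total ys y with hy | hy
  · exact h.nonneg_up hφ hy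
  · simpa using h.mirror.nonneg_up (mono_mirror hφ) (neg_le_neg hy)

lemma Kap.pos_up {φ κ : ℝ → ℝ} {c z0 ys e : ℝ} (h : Kap φ c z0 ys κ) (hφ : Monotone φ)
    (hφc : Continuous φ) (he : ys < e) (hpos : 0 < φ e + c * z0) : 0 < κ e := by
  rcases (h.nonneg_up hφ he.le).eq_or_lt with h0 | h0
  · exfalso
    have hev : ∀ᶠ y in nhdsWithin e (Iio e), 0 < φ y + c * z0 := by
      apply nhdsWithin_le_nhds
      exact ContinuousAt.eventually_lt continuousAt_const
        (by fun_prop) hpos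
    have hev2 : ∀ᶠ y in nhdsWithin e (Iio e), y ∈ Ioo ys e := Ioo_mem_nhdsLT he
    obtain ⟨y0, hy0, hy1⟩ := (hev.and hev2).exists
    exact no_return (v := κ) (K := c) h.cont.continuousOn h.zero h0.symm
      (fun s _ => h.der s) (fun s hs => by
      have := h.psi_nonneg hφ hs.1.le
      linarith) hy1 (by linarith)
  · exact h0

lemma Kap.mono_up {φ κ : ℝ → ℝ} {c z0 ys : ℝ} (h : Kap φ c z0 ys κ) (hφ : Monotone φ) :
    MonotoneOn κ (Ici ys) := by
  have key : ∀ y, ys ≤ y → 0 ≤ φ y + c * z0 - c * κ y := by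
    intro y0 hy
    have hk := h.nonneg_up hφ hy
    have hp := h.psi_nonneg hφ hy
    rcases le_total c 0 with hc | hc
    · nlinarith
    have hm := exp_mono (v := fun s => (φ y0 + c * z0) - c * κ s) (b := ys) (t := y0) (K := c)
      (d := fun s => 0 - c * (φ s + c * z0 - c * κ s))
      (by have := h.cont; fun_prop)
      (fun s _ => (hasDerivAt_const s (φ y0 + c * z0)).sub ((h.der s).const_mul c))
      (fun s hs => by
        have := hφ hs.2.le
        nlinarith)
    have := hm ⟨le_refl _, hy⟩ ⟨hy, le_refl _⟩ hy
    simp only [h.zero, mul_zero, sub_zero] at this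
    have h2 : 0 ≤ Real.exp (c * y0) * (φ y0 + c * z0 - c * κ y0) :=
      le_trans (mul_nonneg (Real.exp_pos _).le hp) this
    exact nonneg_of_mul_nonneg_right h2 (Real.exp_pos _)
  apply monotoneOn_of_deriv_nonneg (convex_Ici ys) h.cont.continuousOn
  · intro y _
    exact (h.der y).differentiableAt.differentiableWithinAt
  · intro y hy
    rw [interior_Ici] at hy
    rw [(h.der y).deriv]
    exact key y hy.le

/-- decomposition of an arc relative to the level `z0` -/
structure Dec (φ F : ℝ → ℝ) (b t : ℝ) (z : ℝ → ℝ) (z0 d e : ℝ) : Prop where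
  hbd : b < d
  hde : d < e
  het : e < t
  zd : z d = z0
  ze : z e = z0
  mid : ∀ y ∈ Ioo d e, z0 < z y
  up : ∀ y ∈ Ico e t, 0 < φ y + F (z y)
  low : ∀ y ∈ Ioc b d, φ y + F (z y) < 0
  anti : StrictAntiOn z (Icc e t)
  mono : StrictMonoOn z (Icc b d)

lemma Dec.mirror {φ F z : ℝ → ℝ} {b t z0 d e : ℝ} (h : Dec φ F b t z z0 d e) :
    Dec (fun y => -φ (-y)) (fun ζ => -F ζ) (-t) (-b) (fun y => z (-y)) z0 (-e) (-d) where
  hbd := by linarith [h.het]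
  hde := by linarith [h.hde]
  het := by linarith [h.hbd]
  zd := by simpa using h.ze
  ze := by simpa using h.zd
  mid := fun y hy => h.mid (-y) ⟨by linarith [hy.2], by linarith [hy.1]⟩
  up := fun y hy => by
    have := h.low (-y) ⟨by linarith [hy.2], by linarith [hy.1]⟩
    linarith
  low := fun y hy => by
    have := h.up (-y) ⟨by linarith [hy.2], by linarith [hy.1]⟩
    linarith
  anti := fun p hp q hq hpq => h.mono ⟨by linarith [hq.2], by linarith [hq.1]⟩
    ⟨by linarith [hp.2], by linarith [hp.1]⟩ (by linarith)
  mono := fun p hp q hq hpq => h.anti ⟨by linarith [hq.2], by linarith [hq.1]⟩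
    ⟨by linarith [hp.2], by linarith [hp.1]⟩ (by linarith)

lemma Arc.decomp {φ F : ℝ → ℝ} {m b t z0 yM : ℝ} {z : ℝ → ℝ} (hz : Arc φ F m b t z)
    (hφ : Monotone φ) (hF : LowSlope F m) (hF' : LowSlope (fun ζ => -F ζ) m)
    (h0 : 0 < z0) (hyM : yM ∈ Ioo b t) (hM : z0 < z yM) :
    ∃ d e, Dec φ F b t z z0 d e := by
  obtain ⟨e, h1, h2, h3, h4, h5, h6⟩ := hz.decomp_up hφ hF hF' h0 hyM hM
  obtain ⟨d, g1, g2, g3, g4, g5, g6⟩ := hz.mirror.decomp_up (yM := -yM) (mono_mirror hφ) hF'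
    (by simpa using hF) h0 ⟨by linarith [hyM.2], by linarith [hyM.1]⟩ (by simpa using hM)
  refine ⟨-d, e, by linarith, by linarith, h2, g3, h3, ?_, fun y hy => h5 y hy.1 hy.2, ?_, h6, ?_⟩
  · intro y hy
    rcases le_total yM y with h | h
    · exact h4 y h hy.2
    · have := g4 (-y) (by linarith) (by linarith [hy.1])
      simpa using this
  · intro y hy
    have := g5 (-y) (by linarith [hy.2]) (by linarith [hy.1])
    simp only [neg_neg] at this
    linarith
  · intro p hp q hq hpq
    have := g6 (a := -q) ⟨by linarith [hq.2], by linarith [hq.1]⟩ (b := -p)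
      ⟨by linarith [hp.2], by linarith [hp.1]⟩ (by linarith)
    simpa using this

lemma Dec.lt_of_gt {φ F z : ℝ → ℝ} {b t z0 d e y : ℝ} (h : Dec φ F b t z z0 d e)
    (hy : y ∈ Icc b t) (hz : z0 < z y) : d < y ∧ y < e := by
  constructor
  · by_contra hc
    push Not at hc
    have := h.mono.monotoneOn ⟨hy.1, hc⟩ ⟨h.hbd.le, le_refl _⟩ hc
    rw [h.zd] at this
    linarith
  · by_contra hc
    push Not at hc
    have := h.anti.antitoneOn ⟨le_refl _, h.het.le⟩ ⟨hc, hy.2⟩ hc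
    rw [h.ze] at this
    linarith

lemma Dec.ys_lt {φ F z : ℝ → ℝ} {b t z0 d e c ys : ℝ} (h : Dec φ F b t z z0 d e)
    (hφ : Monotone φ) (hys : φ ys = -c * z0) (hF : F z0 = c * z0) :
    d < ys ∧ ys < e ∧ 0 < φ e + c * z0 ∧ φ d + c * z0 < 0 := by
  have h1 := h.up e ⟨le_refl _, h.het⟩
  have h2 := h.low d ⟨h.hbd, le_refl _⟩
  rw [h.ze, hF] at h1
  rw [h.zd, hF] at h2
  refine ⟨?_, ?_, h1, h2⟩
  · apply hφ.reflect_lt; linarith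
  · apply hφ.reflect_lt; linarith


/-- change of variables on a strictly decreasing end of an arc -/
lemma end_cov {z z' h : ℝ → ℝ} {e t : ℝ} (het : e < t) (hz : StrictAntiOn z (Icc e t))
    (hc : ContinuousOn z (Icc e t)) (hd : ∀ y ∈ Ioo e t, HasDerivAt z (z' y) y)
    (hneg : ∀ y ∈ Ioo e t, z' y < 0) (hh : ContinuousOn h (Icc e t)) :
    (∫ y in e..t, h y) = (∫ ζ in Ioo (z t) (z e), h (Function.invFunOn z (Ioo e t) ζ) /
        (-z' (Function.invFunOn z (Ioo e t) ζ))) ∧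
      MeasureTheory.IntegrableOn (fun ζ => h (Function.invFunOn z (Ioo e t) ζ) /
        (-z' (Function.invFunOn z (Ioo e t) ζ))) (Ioo (z t) (z e)) := by
  have himg : z '' Ioo e t = Ioo (z t) (z e) := by
    apply Subset.antisymm
    · rintro _ ⟨y, hy, rfl⟩
      exact ⟨hz ⟨hy.1.le, hy.2.le⟩ ⟨het.le, le_refl _⟩ hy.2,
        hz ⟨le_refl _, het.le⟩ ⟨hy.1.le, hy.2.le⟩ hy.1⟩
    · exact intermediate_value_Ioo' het.le hc
  have hinj : InjOn z (Ioo e t) := (hz.mono Ioo_subset_Icc_self).injOn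
  have hu : ∀ y ∈ Ioo e t, Function.invFunOn z (Ioo e t) (z y) = y := fun y hy =>
    hinj (Function.invFunOn_mem ⟨y, hy, rfl⟩) hy (Function.invFunOn_eq ⟨y, hy, rfl⟩)
  have hd' : ∀ y ∈ Ioo e t, HasDerivWithinAt z (z' y) (Ioo e t) y := fun y hy =>
    (hd y hy).hasDerivWithinAt
  have hcongr : ∀ y ∈ Ioo e t, |z' y| • (h (Function.invFunOn z (Ioo e t) (z y)) /
        (-z' (Function.invFunOn z (Ioo e t) (z y)))) = h y := by
    intro y hy
    rw [hu y hy, abs_of_neg (hneg y hy), smul_eq_mul]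
    have := (hneg y hy).ne
    field_simp
  have hIntg : MeasureTheory.IntegrableOn h (Ioo e t) :=
    (hh.integrableOn_Icc).mono_set Ioo_subset_Icc_self
  constructor
  · rw [← himg, MeasureTheory.integral_image_eq_integral_abs_deriv_smul measurableSet_Ioo hd' hinj,
      intervalIntegral.integral_of_le het.le, MeasureTheory.integral_Ioc_eq_integral_Ioo]
    exact MeasureTheory.setIntegral_congr_fun measurableSet_Ioo (fun y hy => (hcongr y hy).symm)
  · rw [← himg, MeasureTheory.integrableOn_image_iff_integrableOn_abs_deriv_smul
      measurableSet_Ioo hd' hinj]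
    exact hIntg.congr_fun (fun y hy => (hcongr y hy).symm) measurableSet_Ioo

lemma end_compare {φ F κ q z Z : ℝ → ℝ} {z0 ys e t E T : ℝ}
    (het : e < t) (hET : E < T) (hys : ys ≤ e) (htT : t ≤ T)
    (hφ : Monotone φ) (hκ : MonotoneOn κ (Ici ys))
    (hz : StrictAntiOn z (Icc e t)) (hZ : StrictAntiOn Z (Icc E T))
    (hzc : ContinuousOn z (Icc e t)) (hZc : ContinuousOn Z (Icc E T))
    (hzd : ∀ y ∈ Ioo e t, HasDerivAt z (-φ y - F (z y)) y)
    (hZd : ∀ y ∈ Ioo E T, HasDerivAt Z (-φ y - F (Z y)) y)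
    (hzn : ∀ y ∈ Ioo e t, 0 < φ y + F (z y)) (hZn : ∀ y ∈ Ioo E T, 0 < φ y + F (Z y))
    (hze : z e = z0) (hZe : Z E = z0) (hzt : z t = 0) (hZt : Z T = 0)
    (hlt : ∀ y ∈ Icc e t, z y < Z y)
    (hq : ∀ ζ ∈ Icc 0 z0, 0 ≤ q ζ)
    (hzL : ∀ y ∈ Icc e t, 0 < z y - z0 + κ y)
    (hzh : ContinuousOn (fun y => q (z y) / (z y - z0 + κ y)) (Icc e t))
    (hZh : ContinuousOn (fun y => q (Z y) / (Z y - z0 + κ y)) (Icc E T)) :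
    ∫ y in E..T, q (Z y) / (Z y - z0 + κ y) ≤ ∫ y in e..t, q (z y) / (z y - z0 + κ y) := by
  obtain ⟨i1, j1⟩ := end_cov het hz hzc hzd (fun y hy => by linarith [hzn y hy]) hzh
  obtain ⟨i2, j2⟩ := end_cov hET hZ hZc hZd (fun y hy => by linarith [hZn y hy]) hZh
  rw [hze, hzt] at i1 j1
  rw [hZe, hZt] at i2 j2
  rw [i1, i2]
  refine MeasureTheory.setIntegral_mono_on j2 j1 measurableSet_Ioo ?_
  intro ζ hζ
  have m1 : ζ ∈ z '' Ioo e t := intermediate_value_Ioo' het.le hzc (by rwa [hze, hzt])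
  have m2 : ζ ∈ Z '' Ioo E T := intermediate_value_Ioo' hET.le hZc (by rwa [hZe, hZt])
  have a1 := Function.invFunOn_mem m1
  have a2 := Function.invFunOn_mem m2
  have b1 := Function.invFunOn_eq m1
  have b2 := Function.invFunOn_eq m2
  set y := Function.invFunOn z (Ioo e t) ζ
  set Y := Function.invFunOn Z (Ioo E T) ζ
  have hyY : y ≤ Y := by
    by_contra hc
    push Not at hc
    have c1 := hlt y ⟨a1.1.le, a1.2.le⟩
    have c2 := hZ (a := Y) ⟨a2.1.le, a2.2.le⟩ (b := y) ⟨(a2.1.trans hc).le, a1.2.le.trans htT⟩ hc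
    linarith
  have k1 : κ y ≤ κ Y := hκ (hys.trans a1.1.le) (hys.trans (a1.1.le.trans hyY)) hyY
  have k2 := hφ hyY
  have l1 := hzL y ⟨a1.1.le, a1.2.le⟩
  have n1 := hzn y a1
  rw [b1] at l1 n1
  have q0 := hq ζ ⟨hζ.1.le, hζ.2.le⟩
  simp only [b1, b2]
  apply div_le_div₀
  · positivity
  · apply div_le_div_of_nonneg_left q0 l1
    linarith
  · linarith
  · linarith

/-- facts on convex functions relative to a chord -/
lemma cvx_le {F : ℝ → ℝ} {c z0 M : ℝ} (hF : ConvexOn ℝ (Icc 0 M) F) (h0 : F 0 = 0)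
    (hz0 : 0 < z0) (hz0M : z0 ≤ M) (hFz : F z0 = c * z0) :
    ∀ ζ ∈ Icc 0 z0, 0 ≤ c * ζ - F ζ := by
  intro ζ hζ
  have g1 : 0 ≤ 1 - ζ / z0 := by
    rw [sub_nonneg, div_le_one hz0]; exact hζ.2
  have g2 : 0 ≤ ζ / z0 := div_nonneg hζ.1 hz0.le
  have g3 : (0:ℝ) ∈ Icc 0 M := ⟨le_refl _, by linarith⟩
  have g4 : z0 ∈ Icc 0 M := ⟨hz0.le, hz0M⟩
  have h := hF.2 g3 g4 g1 g2 (by ring)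
  simp only [smul_eq_mul, h0, hFz, mul_zero, zero_add] at h
  have e1 : ζ / z0 * z0 = ζ := by field_simp
  have e2 : ζ / z0 * (c * z0) = c * ζ := by field_simp
  rw [e1, e2] at h
  linarith

lemma cvx_slope {F : ℝ → ℝ} {c z0 M p q : ℝ} (hF : ConvexOn ℝ (Icc 0 M) F)
    (hz0 : 0 < z0) (hFz : F z0 = c * z0) (hp : z0 < p) (hpq : p < q) (hq : q ≤ M) :
    (F p - c * p) * (q - z0) ≤ (F q - c * q) * (p - z0) := by
  have h := hF.slope_mono_adjacent (x := z0) (y := p) (z := q) ⟨hz0.le, by linarith⟩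
    ⟨by linarith, hq⟩ hp hpq
  rw [div_le_div_iff₀ (by linarith) (by linarith)] at h
  nlinarith

lemma cvx_ge {F : ℝ → ℝ} {c z0 M : ℝ} (hF : ConvexOn ℝ (Icc 0 M) F) (h0 : F 0 = 0)
    (hz0 : 0 < z0) (hFz : F z0 = c * z0) :
    ∀ ζ, z0 ≤ ζ → ζ ≤ M → 0 ≤ F ζ - c * ζ := by
  intro ζ h1 h2
  rcases h1.eq_or_lt with rfl | h1
  · linarith
  have h := hF.slope_mono_adjacent (x := 0) (y := z0) (z := ζ) ⟨le_refl _, by linarith⟩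
    ⟨by linarith, h2⟩ hz0 h1
  rw [div_le_div_iff₀ (by linarith) (by linarith), h0, hFz] at h
  by_contra hc
  push Not at hc
  nlinarith

lemma cvx_gt {F : ℝ → ℝ} {c z0 M p : ℝ} (hF : ConvexOn ℝ (Icc 0 M) F)
    (hp0 : 0 ≤ p) (hp : p < z0) (hFz : F z0 = c * z0) (hFp : F p < c * p) :
    ∀ ζ, z0 < ζ → ζ ≤ M → 0 < F ζ - c * ζ := by
  intro ζ h1 h2
  have h := hF.slope_mono_adjacent (x := p) (y := z0) (z := ζ) ⟨hp0, by linarith⟩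
    ⟨by linarith, h2⟩ hp h1
  rw [div_le_div_iff₀ (by linarith) (by linarith), hFz] at h
  by_contra hc
  push Not at hc
  nlinarith

lemma J_cont {F κ z : ℝ → ℝ} {m M b t z0 c : ℝ} (hFc : ContinuousOn F (Icc 0 M)) (hmM : m ≤ M)
    (hκ : Continuous κ) (hz : ContinuousOn z (Icc b t)) (hz0 : ∀ y ∈ Icc b t, 0 ≤ z y)
    (hzm : ∀ y ∈ Icc b t, z y ≤ m) (hL : ∀ y ∈ Icc b t, 0 < z y - z0 + κ y) :
    ContinuousOn (fun y => (F (z y) - c * z y) / (z y - z0 + κ y)) (Icc b t) := by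
  apply ContinuousOn.div
  · apply ContinuousOn.sub
    · exact hFc.comp hz (fun y hy => ⟨hz0 y hy, (hzm y hy).trans hmM⟩)
    · exact continuousOn_const.mul hz
  · exact (hz.sub continuousOn_const).add hκ.continuousOn
  · intro y hy
    exact (hL y hy).ne'

lemma end_up {φ F κ q z Z : ℝ → ℝ} {m b t b' t' z0 c ys d e D E : ℝ}
    (hφ : Monotone φ) (hκ : Kap φ c z0 ys κ) (az : Arc φ F m b t z) (aZ : Arc φ F m b' t' Z)
    (dz : Dec φ F b t z z0 d e) (dZ : Dec φ F b' t' Z z0 D E) (htT : t ≤ t')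
    (hys : ys ≤ e) (hlt : ∀ y ∈ Icc b t, z y < Z y)
    (hq : ∀ ζ ∈ Icc 0 z0, 0 ≤ q ζ) (hzL : ∀ y ∈ Icc b t, 0 < z y - z0 + κ y)
    (hzh : ContinuousOn (fun y => q (z y) / (z y - z0 + κ y)) (Icc b t))
    (hZh : ContinuousOn (fun y => q (Z y) / (Z y - z0 + κ y)) (Icc b' t')) :
    ∫ y in E..t', q (Z y) / (Z y - z0 + κ y) ≤ ∫ y in e..t, q (z y) / (z y - z0 + κ y) := by
  have hbe : b ≤ e := (dz.hbd.trans dz.hde).le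
  have hbE : b' ≤ E := (dZ.hbd.trans dZ.hde).le
  have s1 : Icc e t ⊆ Icc b t := Icc_subset_Icc hbe le_rfl
  have s2 : Icc E t' ⊆ Icc b' t' := Icc_subset_Icc hbE le_rfl
  have s3 : Ioo e t ⊆ Ioo b t := Ioo_subset_Ioo hbe le_rfl
  have s4 : Ioo E t' ⊆ Ioo b' t' := Ioo_subset_Ioo hbE le_rfl
  exact end_compare dz.het dZ.het hys htT hφ (hκ.mono_up hφ) dz.anti dZ.anti
    (az.cont.mono s1) (aZ.cont.mono s2) (fun y hy => az.der y (s3 hy))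
    (fun y hy => aZ.der y (s4 hy)) (fun y hy => dz.up y ⟨hy.1.le, hy.2⟩)
    (fun y hy => dZ.up y ⟨hy.1.le, hy.2⟩) dz.ze dZ.ze az.zt aZ.zt
    (fun y hy => hlt y (s1 hy)) hq (fun y hy => hzL y (s1 hy)) (hzh.mono s1) (hZh.mono s2)

lemma J_mono {φ F κ z Z : ℝ → ℝ} {m M b t b' t' z0 c ys d e D E : ℝ}
    (hφ : Monotone φ) (hF : ConvexOn ℝ (Icc 0 M) F) (hFc : ContinuousOn F (Icc 0 M))
    (h0 : F 0 = 0) (hz0 : 0 < z0) (hz0M : z0 ≤ M) (hmM : m ≤ M) (hFz : F z0 = c * z0)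
    (hκ : Kap φ c z0 ys κ) (az : Arc φ F m b t z) (aZ : Arc φ F m b' t' Z)
    (dz : Dec φ F b t z z0 d e) (dZ : Dec φ F b' t' Z z0 D E) (hbb : b' ≤ b) (htT : t ≤ t')
    (hlt : ∀ y ∈ Icc b t, z y < Z y)
    (hzL : ∀ y ∈ Icc b t, 0 < z y - z0 + κ y) (hZL : ∀ y ∈ Icc b' t', 0 < Z y - z0 + κ y) :
    (∫ y in b..t, (F (z y) - c * z y) / (z y - z0 + κ y)) ≤
      (∫ y in b'..t', (F (Z y) - c * Z y) / (Z y - z0 + κ y)) ∧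
    ((∃ p ∈ Ioo 0 z0, F p < c * p) → (∫ y in b..t, (F (z y) - c * z y) / (z y - z0 + κ y)) <
      (∫ y in b'..t', (F (Z y) - c * Z y) / (Z y - z0 + κ y))) := by
  obtain ⟨hdy, hye, -, -⟩ := dz.ys_lt hφ hκ.base hFz
  have cz := J_cont (c := c) hFc hmM hκ.cont az.cont az.nonneg az.le hzL
  have cZ := J_cont (c := c) hFc hmM hκ.cont aZ.cont aZ.nonneg aZ.le hZL
  have hbd := dz.hbd
  have hde := dz.hde
  have het := dz.het
  have hBD := dZ.hbd
  have hDE := dZ.hde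
  have hET := dZ.het
  have hq := cvx_le hF h0 hz0 hz0M hFz
  have negq : ∀ (w : ℝ → ℝ) (y : ℝ), (F (w y) - c * w y) / (w y - z0 + κ y) =
      -((c * w y - F (w y)) / (w y - z0 + κ y)) := fun w y => by
    rw [← neg_div]; congr 1; ring
  have cz' : ContinuousOn (fun y => (c * z y - F (z y)) / (z y - z0 + κ y)) (Icc b t) := by
    refine cz.neg.congr (fun y _ => ?_)
    simp only [Pi.neg_apply]; rw [negq]; ring
  have cZ' : ContinuousOn (fun y => (c * Z y - F (Z y)) / (Z y - z0 + κ y)) (Icc b' t') := by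
    refine cZ.neg.congr (fun y _ => ?_)
    simp only [Pi.neg_apply]; rw [negq]; ring
  have up := end_up (q := fun ζ => c * ζ - F ζ) hφ hκ az aZ dz dZ htT hye.le hlt hq hzL cz' cZ'
  have low := end_up (q := fun ζ => c * ζ - F ζ) (mono_mirror hφ) hκ.mirror az.mirror aZ.mirror
    dz.mirror dZ.mirror (neg_le_neg hbb) (neg_le_neg hdy.le)
    (fun y hy => hlt (-y) ⟨by linarith [hy.2], by linarith [hy.1]⟩) hq
    (fun y hy => hzL (-y) ⟨by linarith [hy.2], by linarith [hy.1]⟩)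
    (continuousOn_comp_neg cz') (continuousOn_comp_neg cZ')
  rw [intervalIntegral.integral_comp_neg (fun y => (c * z y - F (z y)) / (z y - z0 + κ y)),
    intervalIntegral.integral_comp_neg (fun y => (c * Z y - F (Z y)) / (Z y - z0 + κ y))] at low
  simp only [neg_neg] at low
  have hdD : D < d := (dZ.lt_of_gt (y := d) ⟨by linarith, by linarith⟩
    (by rw [← dz.zd]; exact hlt d ⟨by linarith, by linarith⟩)).1
  have heE : e < E := (dZ.lt_of_gt (y := e) ⟨by linarith, by linarith⟩
    (by rw [← dz.ze]; exact hlt e ⟨by linarith, by linarith⟩)).2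
  have iz : ∀ p q, b ≤ p → p ≤ q → q ≤ t → IntervalIntegrable
      (fun y => (F (z y) - c * z y) / (z y - z0 + κ y)) MeasureTheory.volume p q := by
    intro p q h1 h2 h3
    apply ContinuousOn.intervalIntegrable
    rw [uIcc_of_le h2]
    exact cz.mono (Icc_subset_Icc h1 h3)
  have iZ : ∀ p q, b' ≤ p → p ≤ q → q ≤ t' → IntervalIntegrable
      (fun y => (F (Z y) - c * Z y) / (Z y - z0 + κ y)) MeasureTheory.volume p q := by
    intro p q h1 h2 h3
    apply ContinuousOn.intervalIntegrable
    rw [uIcc_of_le h2]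
    exact cZ.mono (Icc_subset_Icc h1 h3)
  have sz : (∫ y in b..t, (F (z y) - c * z y) / (z y - z0 + κ y)) =
      (∫ y in b..d, (F (z y) - c * z y) / (z y - z0 + κ y)) +
      (∫ y in d..e, (F (z y) - c * z y) / (z y - z0 + κ y)) +
      (∫ y in e..t, (F (z y) - c * z y) / (z y - z0 + κ y)) := by
    rw [intervalIntegral.integral_add_adjacent_intervals (iz _ _ _ _ _) (iz _ _ _ _ _),
      intervalIntegral.integral_add_adjacent_intervals (iz _ _ _ _ _) (iz _ _ _ _ _)] <;> linarith
  have sZ : (∫ y in b'..t', (F (Z y) - c * Z y) / (Z y - z0 + κ y)) =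
      (∫ y in b'..D, (F (Z y) - c * Z y) / (Z y - z0 + κ y)) +
      (∫ y in D..d, (F (Z y) - c * Z y) / (Z y - z0 + κ y)) +
      (∫ y in d..e, (F (Z y) - c * Z y) / (Z y - z0 + κ y)) +
      (∫ y in e..E, (F (Z y) - c * Z y) / (Z y - z0 + κ y)) +
      (∫ y in E..t', (F (Z y) - c * Z y) / (Z y - z0 + κ y)) := by
    rw [intervalIntegral.integral_add_adjacent_intervals (iZ _ _ _ _ _) (iZ _ _ _ _ _),
      intervalIntegral.integral_add_adjacent_intervals (iZ _ _ _ _ _) (iZ _ _ _ _ _),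
      intervalIntegral.integral_add_adjacent_intervals (iZ _ _ _ _ _) (iZ _ _ _ _ _),
      intervalIntegral.integral_add_adjacent_intervals (iZ _ _ _ _ _) (iZ _ _ _ _ _)] <;> linarith
  have up' : (∫ y in e..t, (F (z y) - c * z y) / (z y - z0 + κ y)) ≤
      ∫ y in E..t', (F (Z y) - c * Z y) / (Z y - z0 + κ y) := by
    simp only [negq z, negq Z, intervalIntegral.integral_neg]
    linarith
  have low' : (∫ y in b..d, (F (z y) - c * z y) / (z y - z0 + κ y)) ≤
      ∫ y in b'..D, (F (Z y) - c * Z y) / (Z y - z0 + κ y) := by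
    simp only [negq z, negq Z, intervalIntegral.integral_neg]
    linarith
  have hmidZ : ∀ y ∈ Icc D E, z0 ≤ Z y := by
    intro y hy
    rcases hy.1.eq_or_lt with rfl | h1
    · exact dZ.zd.ge
    rcases hy.2.eq_or_lt with rfl | h2
    · exact dZ.ze.ge
    exact (dZ.mid y ⟨h1, h2⟩).le
  have nnZ : ∀ y ∈ Icc D E, 0 ≤ (F (Z y) - c * Z y) / (Z y - z0 + κ y) := by
    intro y hy
    have hyI : y ∈ Icc b' t' := ⟨hBD.le.trans hy.1, hy.2.trans hET.le⟩
    exact div_nonneg (cvx_ge hF h0 hz0 hFz _ (hmidZ y hy) ((aZ.le y hyI).trans hmM))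
      (hZL y hyI).le
  have m1 : 0 ≤ ∫ y in D..d, (F (Z y) - c * Z y) / (Z y - z0 + κ y) :=
    intervalIntegral.integral_nonneg hdD.le (fun y hy => nnZ y ⟨hy.1, by linarith [hy.2]⟩)
  have m2 : 0 ≤ ∫ y in e..E, (F (Z y) - c * Z y) / (Z y - z0 + κ y) :=
    intervalIntegral.integral_nonneg heE.le (fun y hy => nnZ y ⟨by linarith [hy.1], hy.2⟩)
  have m3 : (∫ y in d..e, (F (z y) - c * z y) / (z y - z0 + κ y)) ≤
      ∫ y in d..e, (F (Z y) - c * Z y) / (Z y - z0 + κ y) := by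
    apply intervalIntegral.integral_mono_on hde.le
      (iz _ _ (by linarith) (by linarith) (by linarith))
      (iZ _ _ (by linarith) (by linarith) (by linarith))
    intro y hy
    have hyI : y ∈ Icc b t := ⟨hbd.le.trans hy.1, hy.2.trans het.le⟩
    have hyI' : y ∈ Icc b' t' := ⟨hbb.trans hyI.1, hyI.2.trans htT⟩
    have hge : z0 ≤ z y := by
      rcases hy.1.eq_or_lt with rfl | h1
      · exact dz.zd.ge
      rcases hy.2.eq_or_lt with rfl | h2
      · exact dz.ze.ge
      exact (dz.mid y ⟨h1, h2⟩).le
    rcases hge.eq_or_lt with hge | hge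
    · rw [← hge, hFz, sub_self, zero_div]
      exact nnZ y ⟨by linarith [hy.1], by linarith [hy.2]⟩
    · have l1 := hzL y hyI
      have l2 := hZL y hyI'
      have hzZ := hlt y hyI
      have hZM := (aZ.le y hyI').trans hmM
      have sl := cvx_slope hF hz0 hFz hge hzZ hZM
      have k0 := hκ.nonneg hφ y
      have p1 := cvx_ge hF h0 hz0 hFz (z y) hge.le (by linarith)
      have p2 := cvx_ge hF h0 hz0 hFz (Z y) (by linarith) hZM
      rw [div_le_div_iff₀ l1 l2]
      have : F (z y) - c * z y ≤ F (Z y) - c * Z y := by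
        by_contra hc
        push Not at hc
        nlinarith
      nlinarith
  refine ⟨by linarith, ?_⟩
  rintro ⟨p, hp, hFp⟩
  have m4 : 0 < ∫ y in e..E, (F (Z y) - c * Z y) / (Z y - z0 + κ y) := by
    apply intervalIntegral.integral_pos heE (cZ.mono (Icc_subset_Icc (by linarith) hET.le))
    · exact fun y hy => nnZ y ⟨by linarith [hy.1], hy.2⟩
    · refine ⟨e, ⟨le_refl _, heE.le⟩, ?_⟩
      have heI : e ∈ Icc b' t' := ⟨by linarith, by linarith⟩
      refine div_pos ?_ (hZL e heI)
      apply cvx_gt hF hp.1.le hp.2 hFz hFp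
      · rw [← dz.ze]; exact hlt e ⟨by linarith, by linarith⟩
      · exact (aZ.le e heI).trans hmM
  linarith


lemma L_der {φ F κ z : ℝ → ℝ} {m b t z0 c ys y : ℝ} (hκ : Kap φ c z0 ys κ)
    (az : Arc φ F m b t z) (hy : y ∈ Ioo b t) :
    HasDerivAt (fun y => z y - z0 + κ y)
      (-(F (z y) - c * z y) - c * (z y - z0 + κ y)) y :=
  (((az.der y hy).sub_const z0).add (hκ.der y)).congr_deriv (by ring)

lemma L_cont {φ F κ z : ℝ → ℝ} {m b t z0 c ys : ℝ} (hκ : Kap φ c z0 ys κ)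
    (az : Arc φ F m b t z) : ContinuousOn (fun y => z y - z0 + κ y) (Icc b t) :=
  (az.cont.sub continuousOn_const).add hκ.cont.continuousOn

lemma J_eq {φ F κ z : ℝ → ℝ} {m M b t z0 c ys : ℝ} (hFc : ContinuousOn F (Icc 0 M)) (hmM : m ≤ M)
    (hκ : Kap φ c z0 ys κ) (az : Arc φ F m b t z)
    (hL : ∀ y ∈ Icc b t, 0 < z y - z0 + κ y) :
    (∫ y in b..t, (F (z y) - c * z y) / (z y - z0 + κ y)) =
      (-Real.log (0 - z0 + κ t) - c * t) - (-Real.log (0 - z0 + κ b) - c * b) := by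
  have hbt : b ≤ t := (az.hb.trans az.ht).le
  have := intervalIntegral.integral_eq_sub_of_hasDerivAt_of_le
    (f := fun y => -Real.log (z y - z0 + κ y) - c * y)
    (f' := fun y => (F (z y) - c * z y) / (z y - z0 + κ y)) hbt
    (by
      apply ContinuousOn.sub
      · exact ((L_cont hκ az).log (fun y hy => (hL y hy).ne')).neg
      · fun_prop)
    (fun y hy => by
      have h0 := hL y (Ioo_subset_Icc_self hy)
      refine (((L_der hκ az hy).log h0.ne').neg.sub
        ((hasDerivAt_id y).const_mul c)).congr_deriv ?_
      field_simp
      ring)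
    (by
      apply ContinuousOn.intervalIntegrable
      rw [uIcc_of_le hbt]
      exact J_cont hFc hmM hκ.cont az.cont az.nonneg az.le hL)
  rw [this, az.zb, az.zt]

lemma Dec.pos_e {φ F κ z : ℝ → ℝ} {b t z0 c ys d e : ℝ} (hφ : Monotone φ)
    (hφc : Continuous φ) (hκ : Kap φ c z0 ys κ) (dz : Dec φ F b t z z0 d e)
    (hFz : F z0 = c * z0) : 0 < κ e := by
  obtain ⟨_, h2, h3, _⟩ := dz.ys_lt hφ hκ.base hFz
  exact hκ.pos_up hφ hφc h2 h3

lemma upA {φ F κ z : ℝ → ℝ} {m b t z0 c ys d e : ℝ} (hφ : Monotone φ) (hφc : Continuous φ)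
    (hκ : Kap φ c z0 ys κ) (az : Arc φ F m b t z) (dz : Dec φ F b t z z0 d e)
    (hFz : F z0 = c * z0) (hq : ∀ ζ ∈ Icc 0 z0, 0 ≤ c * ζ - F ζ) :
    ∀ y ∈ Icc e t, 0 < z y - z0 + κ y := by
  intro y hy
  have hbe : b < e := dz.hbd.trans dz.hde
  have hm := exp_mono (v := fun y => z y - z0 + κ y) (b := e) (t := t) (K := c)
    ((L_cont hκ az).mono (Icc_subset_Icc hbe.le le_rfl))
    (fun s hs => L_der hκ az ⟨hbe.trans hs.1, hs.2⟩)
    (fun s hs => by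
      have := hq (z s) ⟨az.nonneg s ⟨(hbe.trans hs.1).le, hs.2.le⟩, by
        rw [← dz.ze]
        exact (dz.anti ⟨le_refl _, dz.het.le⟩ ⟨hs.1.le, hs.2.le⟩ hs.1).le⟩
      linarith)
  have h1 := hm ⟨le_refl _, dz.het.le⟩ hy hy.1
  simp only [dz.ze] at h1
  have h2 : 0 < Real.exp (c * e) * (z0 - z0 + κ e) :=
    mul_pos (Real.exp_pos _) (by linarith [dz.pos_e hφ hφc hκ hFz])
  exact pos_of_mul_pos_right (h2.trans_le h1) (Real.exp_pos _).le

lemma upB {φ F κ z : ℝ → ℝ} {m b t z0 c ys d e : ℝ}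
    (hκ : Kap φ c z0 ys κ) (az : Arc φ F m b t z) (dz : Dec φ F b t z z0 d e)
    (hq : ∀ ζ ∈ Icc 0 z0, c * ζ - F ζ ≤ 0) (ht : 0 < 0 - z0 + κ t) :
    ∀ y ∈ Icc e t, 0 < z y - z0 + κ y := by
  intro y hy
  have hbe : b < e := dz.hbd.trans dz.hde
  have hm := exp_mono (v := fun y => -(z y - z0 + κ y)) (b := e) (t := t) (K := c)
    ((L_cont hκ az).mono (Icc_subset_Icc hbe.le le_rfl)).neg
    (fun s hs => (L_der hκ az ⟨hbe.trans hs.1, hs.2⟩).neg)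
    (fun s hs => by
      have := hq (z s) ⟨az.nonneg s ⟨(hbe.trans hs.1).le, hs.2.le⟩, by
        rw [← dz.ze]
        exact (dz.anti ⟨le_refl _, dz.het.le⟩ ⟨hs.1.le, hs.2.le⟩ hs.1).le⟩
      linarith)
  have h1 := hm hy ⟨dz.het.le, le_refl _⟩ hy.2
  simp only [az.zt] at h1
  have h2 : 0 < Real.exp (c * t) * (0 - z0 + κ t) := mul_pos (Real.exp_pos _) ht
  have h3 : 0 < Real.exp (c * y) * (z y - z0 + κ y) := by linarith
  exact pos_of_mul_pos_right h3 (Real.exp_pos _).le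

lemma posL {φ A B κ zA zB : ℝ → ℝ} {m b t z0 c ys d e d' e' : ℝ} (hφ : Monotone φ)
    (hφc : Continuous φ) (hκ : Kap φ c z0 ys κ) (aA : Arc φ A m b t zA) (aB : Arc φ B m b t zB)
    (dA : Dec φ A b t zA z0 d e) (dB : Dec φ B b t zB z0 d' e')
    (hAz : A z0 = c * z0) (hBz : B z0 = c * z0)
    (hqA : ∀ ζ ∈ Icc 0 z0, 0 ≤ c * ζ - A ζ) (hqB : ∀ ζ ∈ Icc 0 z0, c * ζ - B ζ ≤ 0) :
    (∀ y ∈ Icc b t, 0 < zA y - z0 + κ y) ∧ (∀ y ∈ Icc b t, 0 < zB y - z0 + κ y) := by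
  have a1 := upA hφ hφc hκ aA dA hAz hqA
  have t1 := a1 t ⟨dA.het.le, le_refl _⟩
  rw [aA.zt] at t1
  have b1 := upB hκ aB dB hqB t1
  have hφc' : Continuous (fun y => -φ (-y)) := by fun_prop
  have b2 := upA (mono_mirror hφ) hφc' hκ.mirror aB.mirror dB.mirror (by linarith)
    (fun ζ hζ => by linarith [hqB ζ hζ])
  have t2 := b2 (-b) ⟨by linarith [dB.hbd], le_refl _⟩
  simp only [neg_neg, aB.zb] at t2
  have a2 := upB hκ.mirror aA.mirror dA.mirror
    (fun ζ hζ => by linarith [hqA ζ hζ]) (by simpa using t2)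
  constructor
  · intro y hy
    rcases le_or_gt e y with h | h
    · exact a1 y ⟨h, hy.2⟩
    rcases le_or_gt y d with h' | h'
    · simpa using a2 (-y) ⟨by linarith, by linarith [hy.1]⟩
    · linarith [dA.mid y ⟨h', h⟩, hκ.nonneg hφ y]
  · intro y hy
    rcases le_or_gt e' y with h | h
    · exact b1 y ⟨h, hy.2⟩
    rcases le_or_gt y d' with h' | h'
    · simpa using b2 (-y) ⟨by linarith, by linarith [hy.1]⟩
    · linarith [dB.mid y ⟨h', h⟩, hκ.nonneg hφ y]

lemma case_i {φ A B zA zB ZA ZB : ℝ → ℝ} {m M b t b' t' z0 c : ℝ}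
    {d1 e1 d2 e2 d3 e3 d4 e4 : ℝ} (hφ : Monotone φ) (hφc : Continuous φ)
    (hA : ConvexOn ℝ (Icc 0 M) A) (hB : ConvexOn ℝ (Icc 0 M) (fun ζ => -B ζ))
    (hAc : ContinuousOn A (Icc 0 M)) (hBc : ContinuousOn B (Icc 0 M))
    (hA0 : A 0 = 0) (hB0 : B 0 = 0) (hz0 : 0 < z0) (hz0M : z0 ≤ M) (hmM : m ≤ M)
    (hAz : A z0 = c * z0) (hBz : B z0 = c * z0) (hlt : A (z0 / 2) < B (z0 / 2))
    (aA : Arc φ A m b t zA) (aB : Arc φ B m b t zB)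
    (cA : Arc φ A m b' t' ZA) (cB : Arc φ B m b' t' ZB)
    (dA : Dec φ A b t zA z0 d1 e1) (dB : Dec φ B b t zB z0 d2 e2)
    (gA : Dec φ A b' t' ZA z0 d3 e3) (gB : Dec φ B b' t' ZB z0 d4 e4)
    (hbb : b' < b) (htt : t < t')
    (hltA : ∀ y ∈ Icc b t, zA y < ZA y) (hltB : ∀ y ∈ Icc b t, zB y < ZB y) : False := by
  have hqA := cvx_le hA hA0 hz0 hz0M hAz
  have hqB' := cvx_le (c := -c) hB (by simp [hB0]) hz0 hz0M (by linarith)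
  have hqB : ∀ ζ ∈ Icc 0 z0, c * ζ - B ζ ≤ 0 := fun ζ hζ => by linarith [hqB' ζ hζ]
  obtain ⟨ys, hys⟩ : ∃ ys, φ ys = -c * z0 := by
    have h1 := dA.up e1 ⟨le_refl _, dA.het⟩
    have h2 := dA.low d1 ⟨dA.hbd, le_refl _⟩
    rw [dA.ze, hAz] at h1
    rw [dA.zd, hAz] at h2
    obtain ⟨ys, _, hys⟩ := intermediate_value_Icc dA.hde.le hφc.continuousOn
      (show -c * z0 ∈ Icc (φ d1) (φ e1) from ⟨by linarith, by linarith⟩)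
    exact ⟨ys, hys⟩
  obtain ⟨κ, hκ⟩ := Kap.exists hφc hys
  obtain ⟨LA, LB⟩ := posL hφ hφc hκ aA aB dA dB hAz hBz hqA hqB
  obtain ⟨MA, MB⟩ := posL hφ hφc hκ cA cB gA gB hAz hBz hqA hqB
  have j1 := J_eq hAc hmM hκ aA LA
  have j2 := J_eq hBc hmM hκ aB LB
  have j3 := J_eq hAc hmM hκ cA MA
  have j4 := J_eq hBc hmM hκ cB MB
  obtain ⟨mA, sA⟩ := J_mono hφ hA hAc hA0 hz0 hz0M hmM hAz hκ aA cA dA gA hbb.le htt.le hltA LA MA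
  obtain ⟨mB, sB⟩ := J_mono (mono_mirror hφ) hB hBc.neg (by simp [hB0]) hz0 hz0M hmM
    (c := -c) (by linarith) hκ.mirror aB.mirror cB.mirror dB.mirror gB.mirror
    (neg_le_neg htt.le) (neg_le_neg hbb.le)
    (fun y hy => hltB (-y) ⟨by linarith [hy.2], by linarith [hy.1]⟩)
    (fun y hy => LB (-y) ⟨by linarith [hy.2], by linarith [hy.1]⟩)
    (fun y hy => MB (-y) ⟨by linarith [hy.2], by linarith [hy.1]⟩)
  have conv : ∀ (w : ℝ → ℝ) (p q : ℝ),
      (∫ y in -q..-p, (-B (w (-y)) - -c * w (-y)) / (w (-y) - z0 + κ (-y))) =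
      -∫ y in p..q, (B (w y) - c * w y) / (w y - z0 + κ y) := by
    intro w p q
    rw [intervalIntegral.integral_comp_neg
      (fun y => (-B (w y) - -c * w y) / (w y - z0 + κ y)), neg_neg, neg_neg,
      ← intervalIntegral.integral_neg]
    congr 1
    ext y
    rw [← neg_div]
    congr 1
    ring
  rw [conv, conv] at mB sB
  rcases lt_or_ge (A (z0 / 2)) (c * (z0 / 2)) with h | h
  · have := sA ⟨z0 / 2, ⟨by linarith, by linarith⟩, h⟩
    linarith
  · have := sB ⟨z0 / 2, ⟨by linarith, by linarith⟩, by linarith⟩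
    linarith

lemma filip_aux {φ A B zA zB : ℝ → ℝ} {m b t z0 K K' : ℝ}
    (hA : SlopeLe A m K) (hB : SlopeLe (fun ζ => -B ζ) m K')
    (aA : Arc φ A m b t zA) (aB : Arc φ B m b t zB) (hz0 : 0 < z0)
    (hlt : ∀ ζ ∈ Ioo 0 z0, A ζ < B ζ) (hle : A z0 ≤ B z0)
    (hz : ∀ y ∈ Icc b t, zA y ≤ z0) : False := by
  have hle' : ∀ ζ, 0 < ζ → ζ ≤ z0 → A ζ ≤ B ζ := by
    intro ζ h1 h2
    rcases h2.eq_or_lt with rfl | h2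
    · exact hle
    · exact (hlt ζ ⟨h1, h2⟩).le
  have hBA : ∀ y ∈ Icc b t, zB y ≤ zA y := by
    intro y hy
    have := gron_fwd (w := fun s => zB s - zA s) (a := b) (b := y) (K := K') hy.1
      ((aB.cont.sub aA.cont).mono (Icc_subset_Icc le_rfl hy.2))
      (by simp [aA.zb, aB.zb]) (by
        intro s hs hpos
        have hs1 : s ∈ Ioo b t := ⟨hs.1, hs.2.trans_le hy.2⟩
        refine ⟨_, (aB.der s hs1).sub (aA.der s hs1), ?_⟩
        have h1 := hB (zA s) (zB s) (aA.pos s hs1).le (by linarith)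
          (aB.le s (Ioo_subset_Icc_self hs1))
        have h2 := hle' (zA s) (aA.pos s hs1) (hz s (Ioo_subset_Icc_self hs1))
        linarith)
    linarith
  have hbt : b < t := aA.hb.trans aA.ht
  obtain ⟨y0, hy0, hy1⟩ : ∃ y0 ∈ Ioo b t, zB y0 < z0 := by
    have hc : ContinuousWithinAt zB (Icc b t) b := aB.cont b ⟨le_refl _, hbt.le⟩
    have hev : ∀ᶠ y in nhdsWithin b (Icc b t), zB y < z0 :=
      hc.eventually (by rw [aB.zb]; exact gt_mem_nhds hz0)
    have hev2 : ∀ᶠ y in nhdsWithin b (Ioi b), zB y < z0 := by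
      have := nhdsWithin_mono b (Ioo_subset_Icc_self : Ioo b t ⊆ Icc b t) hev
      rwa [nhdsWithin_Ioo_eq_nhdsGT hbt] at this
    obtain ⟨y, h1, h2⟩ := (hev2.and (Ioo_mem_nhdsGT hbt)).exists
    exact ⟨y, h2, h1⟩
  refine no_return (v := fun y => zA y - zB y) (K := K) (aA.cont.sub aB.cont)
    (by simp [aA.zb, aB.zb]) (by simp [aA.zt, aB.zt])
    (fun y hy => (aA.der y hy).sub (aB.der y hy)) (fun y hy => ?_) hy0 ?_
  · have h1 := hBA y (Ioo_subset_Icc_self hy)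
    have h2 := hA (zB y) (zA y) (aB.pos y hy).le h1 (aA.le y (Ioo_subset_Icc_self hy))
    have h3 := hle' (zB y) (aB.pos y hy) (h1.trans (hz y (Ioo_subset_Icc_self hy)))
    linarith
  · have h1 := hBA y0 (Ioo_subset_Icc_self hy0)
    have h2 := hA (zB y0) (zA y0) (aB.pos y0 hy0).le h1 (aA.le y0 (Ioo_subset_Icc_self hy0))
    have h3 := hlt (zB y0) ⟨aB.pos y0 hy0, hy1⟩
    linarith

lemma filip {φ A B zA zB : ℝ → ℝ} {m b t z0 K K' : ℝ}
    (hA : SlopeLe A m K) (hB : SlopeLe (fun ζ => -B ζ) m K')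
    (aA : Arc φ A m b t zA) (aB : Arc φ B m b t zB) (hz0 : 0 < z0)
    (hlt : ∀ ζ ∈ Ioo 0 z0, A ζ < B ζ) (hle : A z0 ≤ B z0) :
    (∃ y ∈ Ioo b t, z0 < zA y) ∧ (∃ y ∈ Ioo b t, z0 < zB y) := by
  have ioo : ∀ (C z : ℝ → ℝ), Arc φ C m b t z → (¬ ∀ y ∈ Icc b t, z y ≤ z0) →
      ∃ y ∈ Ioo b t, z0 < z y := by
    intro C z az h
    push Not at h
    obtain ⟨y, hy, h⟩ := h
    refine ⟨y, ⟨lt_of_le_of_ne hy.1 ?_, lt_of_le_of_ne hy.2 ?_⟩, h⟩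
    · rintro rfl; rw [az.zb] at h; linarith
    · rintro rfl; rw [az.zt] at h; linarith
  refine ⟨ioo _ _ aA (filip_aux hA hB aA aB hz0 hlt hle), ioo _ _ aB ?_⟩
  intro hz
  refine filip_aux hA hB aA aB hz0 hlt hle (fun y hy => ?_)
  have := gron_bwd (w := fun s => zA s - zB s) (a := y) (b := t) (K := K) hy.2
    ((aA.cont.sub aB.cont).mono (Icc_subset_Icc hy.1 le_rfl))
    (by simp [aA.zt, aB.zt]) (by
      intro s hs hpos
      have hs1 : s ∈ Ioo b t := ⟨hy.1.trans_lt hs.1, hs.2⟩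
      refine ⟨_, (aA.der s hs1).sub (aB.der s hs1), ?_⟩
      have h1 := hA (zB s) (zA s) (aB.pos s hs1).le (by linarith)
        (aA.le s (Ioo_subset_Icc_self hs1))
      have h2 : A (zB s) ≤ B (zB s) := by
        rcases (hz s (Ioo_subset_Icc_self hs1)).eq_or_lt with h | h
        · rw [h]; exact hle
        · exact (hlt _ ⟨aB.pos s hs1, h⟩).le
      linarith)
  linarith [hz y hy]

lemma case_iii {φ A B zA zB : ℝ → ℝ} {m b t K K' : ℝ}
    (hA : SlopeLe A m K) (hB : SlopeLe (fun ζ => -B ζ) m K')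
    (aA : Arc φ A m b t zA) (aB : Arc φ B m b t zB)
    (hlt : ∀ ζ, 0 < ζ → ζ ≤ m → B ζ < A ζ) : False := by
  have hBA : ∀ y ∈ Icc b t, zA y ≤ zB y := by
    intro y hy
    have := gron_fwd (w := fun s => zA s - zB s) (a := b) (b := y) (K := K') hy.1
      ((aA.cont.sub aB.cont).mono (Icc_subset_Icc le_rfl hy.2))
      (by simp [aA.zb, aB.zb]) (by
        intro s hs hpos
        have hs1 : s ∈ Ioo b t := ⟨hs.1, hs.2.trans_le hy.2⟩
        refine ⟨_, (aA.der s hs1).sub (aB.der s hs1), ?_⟩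
        have h1 := hB (zB s) (zA s) (aB.pos s hs1).le (by linarith)
          (aA.le s (Ioo_subset_Icc_self hs1))
        have h2 := hlt (zA s) (aA.pos s hs1) (aA.le s (Ioo_subset_Icc_self hs1))
        linarith)
    linarith
  have key : ∀ y ∈ Ioo b t, -K * (zB y - zA y) < (-φ y - B (zB y)) - (-φ y - A (zA y)) := by
    intro y hy
    have h1 := hBA y (Ioo_subset_Icc_self hy)
    have h2 := hA (zA y) (zB y) (aA.pos y hy).le h1 (aB.le y (Ioo_subset_Icc_self hy))
    have h3 := hlt (zB y) (aB.pos y hy) (aB.le y (Ioo_subset_Icc_self hy))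
    linarith
  exact no_return (v := fun y => zB y - zA y) (K := K) (aB.cont.sub aA.cont)
    (by simp [aA.zb, aB.zb]) (by simp [aA.zt, aB.zt])
    (fun y hy => (aB.der y hy).sub (aA.der y hy)) (fun y hy => (key y hy).le)
    (y0 := 0) ⟨aA.hb, aA.ht⟩ (key 0 ⟨aA.hb, aA.ht⟩)

theorem scalar {φ A B zA zB ZA ZB : ℝ → ℝ} {m M b t b' t' : ℝ}
    (hφ : Monotone φ) (hφc : Continuous φ)
    (hA : ConvexOn ℝ (Icc 0 M) A) (hB : ConvexOn ℝ (Icc 0 M) (fun ζ => -B ζ))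
    (hAc : ContinuousOn A (Icc 0 M)) (hBc : ContinuousOn B (Icc 0 M))
    (hA0 : A 0 = 0) (hB0 : B 0 = 0) (hm : 0 < m) (hmM : m < M)
    (hne : ∀ δ > 0, ∃ ζ ∈ Ioo 0 δ, A ζ ≠ B ζ)
    (aA : Arc φ A m b t zA) (aB : Arc φ B m b t zB)
    (cA : Arc φ A m b' t' ZA) (cB : Arc φ B m b' t' ZB) (hbb : b' < b) : False := by
  obtain ⟨K, hK⟩ := slopeLe_of_convex hm hmM hA
  obtain ⟨K', hK'⟩ := slopeLe_of_convex hm hmM hB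
  have lA1 := lowSlope_of_convex hmM hA
  have lA2 := lowSlope_neg hK
  have lB1 : LowSlope B m := by simpa using lowSlope_neg hK'
  have lB2 := lowSlope_of_convex hmM hB
  obtain ⟨htt, hltA⟩ := aA.nc cA hK hbb
  obtain ⟨-, hltB⟩ := aB.nc' cB hK' htt
  have hH : ConvexOn ℝ (Icc 0 M) (fun ζ => A ζ - B ζ) := by
    have := hA.add hB
    exact this.congr (fun ζ _ => by simp only [Pi.add_apply]; ring)
  by_cases hex : ∃ z0, 0 < z0 ∧ z0 < M ∧ A z0 = B z0
  · obtain ⟨z0, hz0, hz0M, hABz⟩ := hex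
    have hHle := cvx_le (c := 0) hH (by simp [hA0, hB0]) hz0 hz0M.le (by simp [hABz])
    have hneg : ∀ ζ ∈ Ioo 0 z0, A ζ < B ζ := by
      intro p hp
      have h1 := hHle p ⟨hp.1.le, hp.2.le⟩
      rcases (show A p ≤ B p by linarith).lt_or_eq with h | h
      · exact h
      exfalso
      obtain ⟨ζ, hζ, hζn⟩ := hne p hp.1
      have h2 := hHle ζ ⟨hζ.1.le, (hζ.2.trans hp.2).le⟩
      have h3 := hH.slope_mono_adjacent (x := ζ) (y := p) (z := z0)
        ⟨hζ.1.le, by linarith [hζ.2, hp.2]⟩ ⟨hz0.le, hz0M.le⟩ hζ.2 hp.2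
      rw [h, hABz, sub_self, sub_self, sub_self, zero_div, div_le_iff₀ (by linarith [hζ.2])] at h3
      apply hζn
      linarith
    have hABc : ∃ c, A z0 = c * z0 := ⟨A z0 / z0, by field_simp⟩
    obtain ⟨c, hAz⟩ := hABc
    have hBz : B z0 = c * z0 := by rw [← hABz, hAz]
    obtain ⟨⟨y1, hy1, hy1'⟩, ⟨y2, hy2, hy2'⟩⟩ := filip hK hK' aA aB hz0 hneg hABz.le
    obtain ⟨⟨y3, hy3, hy3'⟩, ⟨y4, hy4, hy4'⟩⟩ := filip hK hK' cA cB hz0 hneg hABz.le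
    obtain ⟨d1, e1, g1⟩ := aA.decomp hφ lA1 lA2 hz0 hy1 hy1'
    obtain ⟨d2, e2, g2⟩ := aB.decomp hφ lB1 lB2 hz0 hy2 hy2'
    obtain ⟨d3, e3, g3⟩ := cA.decomp hφ lA1 lA2 hz0 hy3 hy3'
    obtain ⟨d4, e4, g4⟩ := cB.decomp hφ lB1 lB2 hz0 hy4 hy4'
    exact case_i hφ hφc hA hB hAc hBc hA0 hB0 hz0 hz0M.le hmM.le hAz hBz
      (hneg (z0 / 2) ⟨by linarith, by linarith⟩) aA aB cA cB g1 g2 g3 g4 hbb htt hltA hltB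
  · push Not at hex
    have hHc : ContinuousOn (fun ζ => A ζ - B ζ) (Icc 0 M) := hAc.sub hBc
    rcases lt_or_gt_of_ne (hex m hm hmM) with h | h
    · have hneg : ∀ ζ ∈ Ioo 0 m, A ζ < B ζ := by
        intro ζ hζ
        by_contra hc
        push Not at hc
        obtain ⟨p, hp, hp0⟩ := intermediate_value_Icc' hζ.2.le
          (hHc.mono (Icc_subset_Icc hζ.1.le hmM.le))
          (show (0:ℝ) ∈ Icc (A m - B m) (A ζ - B ζ) from ⟨by linarith, by linarith⟩)
        exact hex p (hζ.1.trans_le hp.1) (hp.2.trans_lt hmM) (by linarith)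
      obtain ⟨⟨y, hy, hy'⟩, -⟩ := filip hK hK' aA aB hm hneg h.le
      linarith [aA.le y (Ioo_subset_Icc_self hy)]
    · refine case_iii hK hK' aA aB (fun ζ h1 h2 => ?_)
      by_contra hc
      push Not at hc
      obtain ⟨p, hp, hp0⟩ := intermediate_value_Icc h2
          (hHc.mono (Icc_subset_Icc h1.le hmM.le))
          (show (0:ℝ) ∈ Icc (A ζ - B ζ) (A m - B m) from ⟨by linarith, by linarith⟩)
      exact hex p (h1.trans_le hp.1) (hp.2.trans_lt hmM) (by linarith)


lemma inv_exists {f : ℝ → ℝ} {p q : ℝ} (hpq : p ≤ q) (hf : StrictMonoOn f (Icc p q))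
    (hc : ContinuousOn f (Icc p q)) :
    ∃ u : ℝ → ℝ, (∀ x ∈ Icc p q, u (f x) = x) ∧
      (∀ ζ ∈ Icc (f p) (f q), u ζ ∈ Icc p q ∧ f (u ζ) = ζ) ∧
      ContinuousOn u (Icc (f p) (f q)) := by
  have hsurj : ∀ ζ ∈ Icc (f p) (f q), ζ ∈ f '' Icc p q := intermediate_value_Icc hpq hc
  have h2 : ∀ ζ ∈ Icc (f p) (f q), Function.invFunOn f (Icc p q) ζ ∈ Icc p q ∧
      f (Function.invFunOn f (Icc p q) ζ) = ζ := fun ζ hζ =>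
    ⟨Function.invFunOn_mem (hsurj ζ hζ), Function.invFunOn_eq (hsurj ζ hζ)⟩
  refine ⟨Function.invFunOn f (Icc p q), ?_, h2, ?_⟩
  · intro x hx
    exact hf.injOn (Function.invFunOn_mem ⟨x, hx, rfl⟩) hx (Function.invFunOn_eq ⟨x, hx, rfl⟩)
  · have hcr : Continuous ((Icc p q).domRestrict f) := continuousOn_iff_continuous_domRestrict.1 hc
    have hemb : Topology.IsClosedEmbedding ((Icc p q).domRestrict f) :=
      hcr.isClosedEmbedding hf.injOn.injective
    let h : Icc (f p) (f q) → Icc p q := fun ζ =>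
      ⟨Function.invFunOn f (Icc p q) ζ, (h2 ζ ζ.2).1⟩
    have hh : Continuous h := by
      rw [hemb.isInducing.continuous_iff]
      exact continuous_subtype_val.congr (fun ζ => (h2 ζ ζ.2).2.symm)
    rw [continuousOn_iff_continuous_domRestrict]
    exact continuous_subtype_val.comp hh

lemma sign_zero {h : ℝ → ℝ} (hc : Continuous h) (hs : ∀ x : ℝ, x ≠ 0 → 0 < x * h x) :
    h 0 = 0 := by
  have hpos : ∀ x : ℝ, 0 < x → 0 < h x := fun x hx => pos_of_mul_pos_right (hs x hx.ne') hx.le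
  have hneg : ∀ x : ℝ, x < 0 → h x < 0 := fun x hx => by
    have := hs x hx.ne
    by_contra hh
    push Not at hh
    nlinarith
  apply le_antisymm
  · have h1 : Filter.Tendsto h (nhdsWithin 0 (Iio 0)) (nhds (h 0)) :=
      hc.continuousAt.tendsto.mono_left nhdsWithin_le_nhds
    exact le_of_tendsto h1 (by
      filter_upwards [self_mem_nhdsWithin] with x hx using (hneg x hx).le)
  · have h1 : Filter.Tendsto h (nhdsWithin 0 (Ioi 0)) (nhds (h 0)) :=
      hc.continuousAt.tendsto.mono_left nhdsWithin_le_nhds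
    exact ge_of_tendsto h1 (by
      filter_upwards [self_mem_nhdsWithin] with x hx using (hpos x hx).le)

/-- standing hypotheses on a system with potential `G` and right inverse `xp` of `G` -/
structure Sys (φ F g G xp : ℝ → ℝ) (X M : ℝ) : Prop where
  φc : Continuous φ
  φs : ∀ y : ℝ, y ≠ 0 → 0 < y * φ y
  Fc : Continuous F
  F0 : F 0 = 0
  gc : Continuous g
  gs : ∀ x : ℝ, x ≠ 0 → 0 < x * g x
  Gd : ∀ x, HasDerivAt G (g x) x
  G0 : G 0 = 0
  hX : 0 < X
  GX : G X = M
  left : ∀ x ∈ Icc 0 X, xp (G x) = x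
  right : ∀ ζ ∈ Icc 0 M, xp ζ ∈ Icc 0 X ∧ G (xp ζ) = ζ
  xpc : ContinuousOn xp (Icc 0 M)

lemma gpos {g : ℝ → ℝ} (hs : ∀ x : ℝ, x ≠ 0 → 0 < x * g x) {x : ℝ} (hx : 0 < x) : 0 < g x :=
  pos_of_mul_pos_right (hs x hx.ne') hx.le

lemma gneg {g : ℝ → ℝ} (hs : ∀ x : ℝ, x ≠ 0 → 0 < x * g x) {x : ℝ} (hx : x < 0) : g x < 0 := by
  have := hs x hx.ne
  by_contra hh
  push Not at hh
  nlinarith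

lemma G_mono {g G : ℝ → ℝ} (gs : ∀ x : ℝ, x ≠ 0 → 0 < x * g x)
    (Gd : ∀ x, HasDerivAt G (g x) x) : StrictMonoOn G (Ici 0) := by
  apply strictMonoOn_of_deriv_pos (convex_Ici 0)
  · exact fun x _ => (Gd x).continuousAt.continuousWithinAt
  · intro x hx
    rw [interior_Ici] at hx
    rw [(Gd x).deriv]
    exact gpos gs hx

lemma Sys.exists_xp {g G : ℝ → ℝ} (gs : ∀ x : ℝ, x ≠ 0 → 0 < x * g x)
    (Gd : ∀ x, HasDerivAt G (g x) x) (G0 : G 0 = 0) {X M : ℝ} (hX : 0 < X) (GX : G X = M) :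
    ∃ xp : ℝ → ℝ, (∀ x ∈ Icc 0 X, xp (G x) = x) ∧
      (∀ ζ ∈ Icc 0 M, xp ζ ∈ Icc 0 X ∧ G (xp ζ) = ζ) ∧ ContinuousOn xp (Icc 0 M) := by
  have := inv_exists hX.le ((G_mono gs Gd).mono Icc_subset_Ici_self)
    (fun x _ => (Gd x).continuousAt.continuousWithinAt)
  rwa [G0, GX] at this

lemma Sys.xp_pos {φ F g G xp : ℝ → ℝ} {X M ζ : ℝ} (S : Sys φ F g G xp X M) (hζ : ζ ∈ Ioc 0 M) :
    0 < xp ζ := by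
  obtain ⟨h1, h2⟩ := S.right ζ ⟨hζ.1.le, hζ.2⟩
  rcases h1.1.eq_or_lt with h | h
  · rw [← h, S.G0] at h2
    linarith [hζ.1]
  · exact h

lemma Sys.xp0 {φ F g G xp : ℝ → ℝ} {X M : ℝ} (S : Sys φ F g G xp X M) : xp 0 = 0 := by
  have := S.left 0 ⟨le_refl _, S.hX.le⟩
  rwa [S.G0] at this

lemma Sys.xp_mono {φ F g G xp : ℝ → ℝ} {X M : ℝ} (S : Sys φ F g G xp X M) :
    MonotoneOn xp (Icc 0 M) := by
  intro p hp q hq hpq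
  obtain ⟨h1, h2⟩ := S.right p hp
  obtain ⟨h3, h4⟩ := S.right q hq
  by_contra hc
  push Not at hc
  have := G_mono S.gs S.Gd h3.1 h1.1 hc
  linarith

lemma Sys.Cder {φ F g G xp f : ℝ → ℝ} {X M ζ : ℝ} (S : Sys φ F g G xp X M)
    (hf : ∀ x, HasDerivAt F (f x) x) (hζ : ζ ∈ Ioo 0 M) :
    HasDerivAt (fun ζ => F (xp ζ)) (f (xp ζ) / g (xp ζ)) ζ := by
  have hx := S.xp_pos ⟨hζ.1, hζ.2.le⟩
  have h1 : HasDerivAt xp (g (xp ζ))⁻¹ ζ := by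
    apply HasDerivAt.of_local_left_inverse
      (S.xpc.continuousAt (Icc_mem_nhds hζ.1 hζ.2)) (S.Gd _) (gpos S.gs hx).ne'
    filter_upwards [Icc_mem_nhds hζ.1 hζ.2] with y hy using (S.right y hy).2
  exact (HasDerivAt.comp ζ (hf (xp ζ)) h1).congr_deriv (by rw [div_eq_mul_inv])

lemma Sys.Ccont {φ F g G xp : ℝ → ℝ} {X M : ℝ} (S : Sys φ F g G xp X M) :
    ContinuousOn (fun ζ => F (xp ζ)) (Icc 0 M) := S.Fc.comp_continuousOn S.xpc

lemma Sys.convex {φ F g G xp f : ℝ → ℝ} {X M : ℝ} (S : Sys φ F g G xp X M)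
    (hf : ∀ x, HasDerivAt F (f x) x) (hm : MonotoneOn (fun x => f x / g x) (Ioi 0)) :
    ConvexOn ℝ (Icc 0 M) (fun ζ => F (xp ζ)) := by
  apply MonotoneOn.convexOn_of_deriv (convex_Icc 0 M) S.Ccont
  · rw [interior_Icc]
    exact fun ζ hζ => (S.Cder hf hζ).differentiableAt.differentiableWithinAt
  · rw [interior_Icc]
    intro p hp q hq hpq
    rw [(S.Cder hf hp).deriv, (S.Cder hf hq).deriv]
    exact hm (S.xp_pos ⟨hp.1, hp.2.le⟩) (S.xp_pos ⟨hq.1, hq.2.le⟩)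
      (S.xp_mono ⟨hp.1.le, hp.2.le⟩ ⟨hq.1.le, hq.2.le⟩ hpq)

lemma Sys.rev {φ F g G xp : ℝ → ℝ} {X M : ℝ} (S : Sys φ F g G xp X M) :
    Sys (fun y => -φ (-y)) (fun x => -F x) g G xp X M :=
  { S with
    φc := by have := S.φc; fun_prop
    φs := fun y hy => by
      have := S.φs (-y) (neg_ne_zero.2 hy)
      linarith
    Fc := S.Fc.neg
    F0 := by simp [S.F0] }

/-- periodic solution avoiding the origin -/
structure Per (φ F g x y : ℝ → ℝ) (T : ℝ) : Prop where
  dx : ∀ t, HasDerivAt x (-φ (y t) - F (x t)) t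
  dy : ∀ t, HasDerivAt y (g (x t)) t
  hT : 0 < T
  px : ∀ t, x (t + T) = x t
  py : ∀ t, y (t + T) = y t
  ne : ∀ t, ¬ (x t = 0 ∧ y t = 0)

lemma Per.rev {φ F g x y : ℝ → ℝ} {T : ℝ} (h : Per φ F g x y T) :
    Per (fun y => -φ (-y)) (fun x => -F x) g (fun s => x (-s)) (fun s => -y (-s)) T where
  dx := fun t => (hasDerivAt_comp_neg' (h.dx (-t))).congr_deriv (by simp only [neg_neg]; ring)
  dy := fun t => (hasDerivAt_comp_neg' (h.dy (-t))).neg.congr_deriv (by ring)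
  hT := h.hT
  px := fun t => by
    have := h.px (-(t + T))
    rw [← this]; congr 1; ring
  py := fun t => by
    have := h.py (-(t + T))
    rw [← this]; congr 2; ring
  ne := fun t ht => h.ne (-t) ⟨ht.1, by linarith [ht.2]⟩

lemma Per.rot {φ F g x y : ℝ → ℝ} {T : ℝ} (h : Per φ F g x y T) :
    Per (fun y => -φ (-y)) (fun x => -F (-x)) (fun x => -g (-x))
      (fun s => -x s) (fun s => -y s) T where
  dx := fun t => (h.dx t).neg.congr_deriv (by simp only [neg_neg]; ring)
  dy := fun t => (h.dy t).neg.congr_deriv (by simp only [neg_neg])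
  hT := h.hT
  px := fun t => by simp only [h.px]
  py := fun t => by simp only [h.py]
  ne := fun t ht => h.ne t ⟨by linarith [ht.1], by linarith [ht.2]⟩

lemma right_pos {x : ℝ → ℝ} {x' a : ℝ} (h : HasDerivAt x x' a) (hx : x a = 0) (hp : 0 < x') :
    ∃ ε > 0, ∀ s, a < s → s < a + ε → 0 < x s := by
  have h1 := (hasDerivAt_iff_tendsto_slope.1 h).eventually (lt_mem_nhds hp)
  have h2 : ∀ᶠ s in nhdsWithin a (Ioi a), 0 < slope x a s :=
    h1.filter_mono (nhdsWithin_mono a (fun s hs => ne_of_gt hs))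
  obtain ⟨u, hu, hs⟩ := (mem_nhdsGT_iff_exists_Ioo_subset).1 h2
  refine ⟨u - a, sub_pos.2 hu, fun s h3 h4 => ?_⟩
  have h5 : 0 < slope x a s := hs ⟨h3, by linarith⟩
  rw [slope_def_field, hx, sub_zero] at h5
  have h6 : 0 < s - a := by linarith
  have := mul_pos h5 h6
  rwa [div_mul_cancel₀ _ h6.ne'] at this

lemma left_neg {x : ℝ → ℝ} {x' a : ℝ} (h : HasDerivAt x x' a) (hx : x a = 0) (hp : 0 < x') :
    ∃ ε > 0, ∀ s, a - ε < s → s < a → x s < 0 := by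
  have h1 : HasDerivAt (fun s => -x (-s)) x' (-a) :=
    (hasDerivAt_comp_neg' (y := -a) (by simpa using h)).neg.congr_deriv (by ring)
  obtain ⟨ε, h2, h3⟩ := right_pos h1 (by simpa using hx) hp
  refine ⟨ε, h2, fun s h4 h5 => ?_⟩
  have := h3 (-s) (by linarith) (by linarith)
  simp only [neg_neg] at this
  linarith


lemma Per.contx {φ F g x y : ℝ → ℝ} {T : ℝ} (h : Per φ F g x y T) : Continuous x :=
  continuous_iff_continuousAt.2 fun t => (h.dx t).continuousAt

lemma Per.conty {φ F g x y : ℝ → ℝ} {T : ℝ} (h : Per φ F g x y T) : Continuous y :=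
  continuous_iff_continuousAt.2 fun t => (h.dy t).continuousAt

/-- the right half of a periodic orbit, started from the minimum of `y`, up to the next zero
of `x` -/
lemma Per.half {φ F g G xp x y : ℝ → ℝ} {T X M a : ℝ} (S : Sys φ F g G xp X M)
    (h : Per φ F g x y T) (ha : ∀ s, y a ≤ y s) :
    x a = 0 ∧ y a < 0 ∧ ∃ s1, a < s1 ∧ x s1 = 0 ∧ (∀ s ∈ Ioo a s1, 0 < x s) ∧ 0 < y s1 := by
  have hφ0 := sign_zero S.φc S.φs
  have hxa : x a = 0 := by
    have hmin : IsLocalMin y a := Filter.Eventually.of_forall ha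
    have h0 := hmin.hasDerivAt_eq_zero (h.dy a)
    by_contra hx
    have := S.gs _ hx
    rw [h0, mul_zero] at this
    exact lt_irrefl _ this
  have hya0 : y a ≠ 0 := fun h0 => h.ne a ⟨hxa, h0⟩
  have hdx := h.dx a
  rw [hxa, S.F0, sub_zero] at hdx
  have hya : y a < 0 := by
    by_contra hc
    have hpos : 0 < y a := lt_of_le_of_ne (not_lt.1 hc) hya0.symm
    have hφp := gpos S.φs hpos
    obtain ⟨ε, hε, hn⟩ := right_pos (x := fun s => -x s) hdx.neg (by simp [hxa]) (by linarith)
    have hanti : StrictAntiOn y (Icc a (a + ε)) := by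
      apply strictAntiOn_of_deriv_neg (convex_Icc _ _) h.conty.continuousOn
      rw [interior_Icc]
      intro s hs
      rw [(h.dy s).deriv]
      apply gneg S.gs
      linarith [hn s hs.1 hs.2]
    have := hanti ⟨le_refl _, by linarith⟩ ⟨by linarith, le_refl _⟩ (by linarith : a < a + ε)
    linarith [ha (a + ε)]
  have hφn := gneg S.φs hya
  obtain ⟨ε, hε, hp⟩ := right_pos hdx hxa (by linarith)
  refine ⟨hxa, hya, ?_⟩
  have hxT : x (a + T) = 0 := by rw [h.px, hxa]
  have hTε : ε ≤ T := by
    by_contra hc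
    push Not at hc
    have := hp (a + T) (by linarith [h.hT]) (by linarith)
    linarith
  have hcomp : IsCompact (Icc (a + ε / 2) (a + T) ∩ x ⁻¹' {0}) :=
    isCompact_Icc.of_isClosed_subset
      (isClosed_Icc.inter (isClosed_singleton.preimage h.contx)) inter_subset_left
  obtain ⟨s1, hs1, hmin⟩ := hcomp.exists_isLeast
    ⟨a + T, ⟨by linarith, le_refl _⟩, hxT⟩
  have hxs1 : x s1 = 0 := hs1.2
  have has1 : a + ε / 2 ≤ s1 := hs1.1.1
  have hpos : ∀ s ∈ Ioo a s1, 0 < x s := by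
    intro s hs
    rcases lt_or_ge s (a + ε) with h1 | h1
    · exact hp s hs.1 h1
    by_contra hc
    push Not at hc
    have hq : 0 < x (a + ε / 2) := hp _ (by linarith) (by linarith)
    obtain ⟨r, hr, hr0⟩ := intermediate_value_Icc' (by linarith : a + ε / 2 ≤ s)
      h.contx.continuousOn (show (0:ℝ) ∈ Icc (x s) (x (a + ε / 2)) from ⟨hc, hq.le⟩)
    have := hmin ⟨⟨hr.1, by linarith [hr.2, hs.2, hs1.1.2]⟩, hr0⟩
    linarith [hr.2, hs.2]
  refine ⟨s1, by linarith, hxs1, hpos, ?_⟩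
  have hy0 : y s1 ≠ 0 := fun h0 => h.ne s1 ⟨hxs1, h0⟩
  by_contra hc
  have hyn : y s1 < 0 := lt_of_le_of_ne (not_lt.1 hc) hy0
  have hd1 := h.dx s1
  rw [hxs1, S.F0, sub_zero] at hd1
  obtain ⟨δ, hδ, hn⟩ := left_neg hd1 hxs1 (by linarith [gneg S.φs hyn])
  obtain ⟨s, hs1', hs2'⟩ := exists_between (show max a (s1 - δ) < s1 from
    max_lt (by linarith) (by linarith))
  have := hn s ((le_max_right _ _).trans_lt hs1') hs2'
  have := hpos s ⟨(le_max_left _ _).trans_lt hs1', hs2'⟩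
  linarith

lemma Per.arc {φ F g G xp x y : ℝ → ℝ} {T X M m a : ℝ} (S : Sys φ F g G xp X M)
    (h : Per φ F g x y T) (ha : ∀ s, y a ≤ y s) (hm : ∀ s, 0 ≤ x s → G (x s) ≤ m) (hmM : m < M) :
    ∃ s1 z, Arc φ (fun ζ => F (xp ζ)) m (y a) (y s1) z := by
  obtain ⟨hxa, hya, s1, has1, hxs1, hpos, hys1⟩ := h.half S ha
  have hmono : StrictMonoOn y (Icc a s1) := by
    apply strictMonoOn_of_deriv_pos (convex_Icc _ _) h.conty.continuousOn
    rw [interior_Icc]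
    intro s hs
    rw [(h.dy s).deriv]
    exact gpos S.gs (hpos s hs)
  obtain ⟨u, hu1, hu2, hu3⟩ := inv_exists has1.le hmono h.conty.continuousOn
  have hGc : Continuous G := continuous_iff_continuousAt.2 fun x => (S.Gd x).continuousAt
  have hioo : ∀ η ∈ Ioo (y a) (y s1), u η ∈ Ioo a s1 := by
    intro η hη
    obtain ⟨h1, h2⟩ := hu2 η ⟨hη.1.le, hη.2.le⟩
    refine ⟨lt_of_le_of_ne h1.1 ?_, lt_of_le_of_ne h1.2 ?_⟩
    · intro h3; rw [← h3] at h2; linarith [hη.1]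
    · intro h3; rw [h3] at h2; linarith [hη.2]
  have hnn : ∀ s ∈ Icc a s1, 0 ≤ x s := by
    intro s hs
    rcases hs.1.eq_or_lt with rfl | h1
    · exact hxa.ge
    rcases hs.2.eq_or_lt with rfl | h2
    · exact hxs1.ge
    exact (hpos s ⟨h1, h2⟩).le
  have hub : u (y a) = a := hu1 a ⟨le_refl _, has1.le⟩
  have hut : u (y s1) = s1 := hu1 s1 ⟨has1.le, le_refl _⟩
  refine ⟨s1, fun η => G (x (u η)), hya, hys1, ?_, ?_, ?_, ?_, ?_, ?_⟩
  · exact (hGc.comp h.contx).comp_continuousOn hu3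
  · simp only [hub, hxa, S.G0]
  · simp only [hut, hxs1, S.G0]
  · intro η hη
    have h1 := hpos _ (hioo η hη)
    have := G_mono S.gs S.Gd (mem_Ici.2 le_rfl) (mem_Ici.2 h1.le) h1
    rwa [S.G0] at this
  · intro η hη
    exact hm _ (hnn _ (hu2 η hη).1)
  · intro η hη
    have hs := hioo η hη
    have hx := hpos _ hs
    have hyu : y (u η) = η := (hu2 η ⟨hη.1.le, hη.2.le⟩).2
    have hgp := gpos S.gs hx
    have hud : HasDerivAt u (g (x (u η)))⁻¹ η := by
      apply HasDerivAt.of_local_left_inverse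
        (hu3.continuousAt (Icc_mem_nhds hη.1 hη.2)) (h.dy _) hgp.ne'
      filter_upwards [Icc_mem_nhds hη.1 hη.2] with p hp using (hu2 p hp).2
    have hd := HasDerivAt.comp η (S.Gd (x (u η))) (HasDerivAt.comp η (h.dx (u η)) hud)
    refine hd.congr_deriv ?_
    have hxX : x (u η) ≤ X := by
      by_contra hc
      push Not at hc
      have h1 := G_mono S.gs S.Gd (mem_Ici.2 S.hX.le) (mem_Ici.2 hx.le) hc
      rw [S.GX] at h1
      linarith [hm _ hx.le]
    rw [S.left _ ⟨hx.le, hxX⟩, hyu]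
    field_simp

lemma Arc.unmirror {φ F : ℝ → ℝ} {m b t : ℝ} {z : ℝ → ℝ}
    (h : Arc (fun y => -φ (-y)) (fun ζ => -F ζ) m b t z) :
    Arc φ F m (-t) (-b) (fun y => z (-y)) := by
  simpa using h.mirror

lemma Per.right_arc {φ F g G xp x y : ℝ → ℝ} {T X M m a e K : ℝ} (S : Sys φ F g G xp X M)
    (h : Per φ F g x y T) (ha : ∀ s, y a ≤ y s) (he : ∀ s, y s ≤ y e)
    (hm : ∀ s, 0 ≤ x s → G (x s) ≤ m) (hmM : m < M)
    (hK : SlopeLe (fun ζ => -F (xp ζ)) m K) :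
    ∃ z, Arc φ (fun ζ => F (xp ζ)) m (y a) (y e) z := by
  obtain ⟨s1, z, hz⟩ := h.arc S ha hm hmM
  obtain ⟨s2, w, hw⟩ := h.rev.arc (a := -e) S.rev
    (fun s => by simp only [neg_neg]; linarith [he (-s)]) (fun s => hm (-s)) hmM
  have hw' := Arc.unmirror (F := fun ζ => F (xp ζ)) hw
  simp only [neg_neg] at hw'
  rcases (he s1).lt_or_eq with hlt | heq
  · have := (hz.nc' hw' hK hlt).1
    linarith [ha (-s2)]
  · rw [heq] at hz
    exact ⟨z, hz⟩


lemma cont_of_lip {h : ℝ → ℝ} (hl : ∀ A B : ℝ, ∃ K : NNReal, LipschitzOnWith K h (Icc A B)) :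
    Continuous h := by
  rw [continuous_iff_continuousAt]
  intro x
  obtain ⟨K, hK⟩ := hl (x - 1) (x + 1)
  exact hK.continuousOn.continuousAt (Icc_mem_nhds (by linarith) (by linarith))

lemma lip_of_deriv {F f : ℝ → ℝ} (hf : ∀ x : ℝ, HasDerivAt F (f x) x) (hfc : Continuous f)
    (A B : ℝ) : ∃ K : NNReal, LipschitzOnWith K F (Icc A B) := by
  obtain ⟨C, hC⟩ := isCompact_Icc.exists_bound_of_continuousOn (s := Icc A B) hfc.continuousOn
  refine ⟨C.toNNReal, ?_⟩
  apply (convex_Icc A B).lipschitzOnWith_of_nnnorm_hasDerivWithin_le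
    (fun x _ => (hf x).hasDerivWithinAt)
  intro x hx
  rw [← NNReal.coe_le_coe, coe_nnnorm]
  exact (hC x hx).trans (Real.le_coe_toNNReal C)

lemma ode_unique {φ F g x y u v : ℝ → ℝ} {R t0 : ℝ}
    (hφ : ∀ A B : ℝ, ∃ K : NNReal, LipschitzOnWith K φ (Icc A B))
    (hF : ∀ A B : ℝ, ∃ K : NNReal, LipschitzOnWith K F (Icc A B))
    (hg : ∀ A B : ℝ, ∃ K : NNReal, LipschitzOnWith K g (Icc A B))
    (dx : ∀ t, HasDerivAt x (-φ (y t) - F (x t)) t) (dy : ∀ t, HasDerivAt y (g (x t)) t)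
    (du : ∀ t, HasDerivAt u (-φ (v t) - F (u t)) t) (dv : ∀ t, HasDerivAt v (g (u t)) t)
    (bx : ∀ t, x t ∈ Icc (-R) R) (bY : ∀ t, y t ∈ Icc (-R) R)
    (bu : ∀ t, u t ∈ Icc (-R) R) (bv : ∀ t, v t ∈ Icc (-R) R)
    (h1 : x t0 = u t0) (h2 : y t0 = v t0) : x = u ∧ y = v := by
  obtain ⟨K1, hK1⟩ := hφ (-R) R
  obtain ⟨K2, hK2⟩ := hF (-R) R
  obtain ⟨K3, hK3⟩ := hg (-R) R
  let w : ℝ × ℝ → ℝ × ℝ := fun p => (-φ p.2 - F p.1, g p.1)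
  let s : Set (ℝ × ℝ) := Icc (-R) R ×ˢ Icc (-R) R
  have m1 : MapsTo Prod.fst s (Icc (-R) R) := fun p hp => hp.1
  have m2 : MapsTo Prod.snd s (Icc (-R) R) := fun p hp => hp.2
  have l1 := hK1.comp (LipschitzWith.prod_snd.lipschitzOnWith (s := s)) m2
  have l2 := hK2.comp (LipschitzWith.prod_fst.lipschitzOnWith (s := s)) m1
  have l3 := hK3.comp (LipschitzWith.prod_fst.lipschitzOnWith (s := s)) m1
  obtain ⟨K, hK⟩ : ∃ K, LipschitzOnWith K w s := ⟨_, (l1.neg.sub l2).prodMk l3⟩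
  have := ODE_solution_unique_univ (v := fun _ => w) (s := fun _ => s) (K := K)
    (f := fun t => (x t, y t)) (g := fun t => (u t, v t)) (t₀ := t0) (fun _ => hK)
    (fun t => ⟨(dx t).prodMk (dy t), bx t, bY t⟩)
    (fun t => ⟨(du t).prodMk (dv t), bu t, bv t⟩) (by simp only [h1, h2])
  constructor
  · funext t
    exact congrArg Prod.fst (congrFun this t)
  · funext t
    exact congrArg Prod.snd (congrFun this t)

lemma periodic_bound {x : ℝ → ℝ} {T : ℝ} (hT : 0 < T) (hp : ∀ t, x (t + T) = x t)
    (hc : Continuous x) : ∃ a e, (∀ s, x a ≤ x s) ∧ (∀ s, x s ≤ x e) := by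
  have hk : IsCompact (range x) := Function.Periodic.compact_of_continuous hp hT.ne' hc
  obtain ⟨_, ⟨a, rfl⟩, ha⟩ := hk.exists_isLeast (range_nonempty x)
  obtain ⟨_, ⟨e, rfl⟩, he⟩ := hk.exists_isGreatest (range_nonempty x)
  exact ⟨a, e, fun s => ha ⟨s, rfl⟩, fun s => he ⟨s, rfl⟩⟩

lemma periodic_abs {x : ℝ → ℝ} {T : ℝ} (hT : 0 < T) (hp : ∀ t, x (t + T) = x t)
    (hc : Continuous x) : ∃ R, 0 < R ∧ ∀ s, x s ∈ Icc (-R) R := by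
  obtain ⟨a, e, ha, he⟩ := periodic_bound hT hp hc
  refine ⟨max 1 (max (-x a) (x e)), by positivity, fun s => ⟨?_, ?_⟩⟩
  · have h1 := le_max_right 1 (max (-x a) (x e))
    have h2 := le_max_left (-x a) (x e)
    linarith [ha s]
  · have h1 := le_max_right 1 (max (-x a) (x e))
    have h2 := le_max_right (-x a) (x e)
    linarith [he s]

lemma per_of_sol {φ F g x y : ℝ → ℝ} {T : ℝ}
    (hφ : ∀ A B : ℝ, ∃ K : NNReal, LipschitzOnWith K φ (Icc A B))
    (hF : ∀ A B : ℝ, ∃ K : NNReal, LipschitzOnWith K F (Icc A B))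
    (hg : ∀ A B : ℝ, ∃ K : NNReal, LipschitzOnWith K g (Icc A B))
    (φ0 : φ 0 = 0) (F0 : F 0 = 0) (g0 : g 0 = 0)
    (dx : ∀ t, HasDerivAt x (-φ (y t) - F (x t)) t) (dy : ∀ t, HasDerivAt y (g (x t)) t)
    (hne : ∃ t₁ t₂ : ℝ, (x t₁, y t₁) ≠ (x t₂, y t₂))
    (hT : 0 < T) (px : ∀ t, x (t + T) = x t) (py : ∀ t, y (t + T) = y t) :
    Per φ F g x y T := by
  refine ⟨dx, dy, hT, px, py, fun t ht => ?_⟩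
  have cx : Continuous x := continuous_iff_continuousAt.2 fun t => (dx t).continuousAt
  have cy : Continuous y := continuous_iff_continuousAt.2 fun t => (dy t).continuousAt
  obtain ⟨R1, p1, b1⟩ := periodic_abs hT px cx
  obtain ⟨R2, p2, b2⟩ := periodic_abs hT py cy
  have q1 := le_max_left R1 R2
  have q2 := le_max_right R1 R2
  have hz : (0 : ℝ) ∈ Icc (-max R1 R2) (max R1 R2) := ⟨by linarith, by linarith⟩
  obtain ⟨e1, e2⟩ := ode_unique (R := max R1 R2) (t0 := t) (u := fun _ => 0) (v := fun _ => 0)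
    hφ hF hg dx dy
    (fun t => (hasDerivAt_const t 0).congr_deriv (by simp [φ0, F0]))
    (fun t => (hasDerivAt_const t 0).congr_deriv (by simp [g0]))
    (fun t => Icc_subset_Icc (by linarith) (by linarith) (b1 t))
    (fun t => Icc_subset_Icc (by linarith) (by linarith) (b2 t))
    (fun _ => hz) (fun _ => hz) ht.1 ht.2
  obtain ⟨t1, t2, h⟩ := hne
  exact h (by rw [e1, e2])

/-- two periodic solutions meeting at one point have the same orbit -/
lemma same_orbit {φ F g x y u v : ℝ → ℝ} {T T2 a b : ℝ}
    (hφ : ∀ A B : ℝ, ∃ K : NNReal, LipschitzOnWith K φ (Icc A B))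
    (hF : ∀ A B : ℝ, ∃ K : NNReal, LipschitzOnWith K F (Icc A B))
    (hg : ∀ A B : ℝ, ∃ K : NNReal, LipschitzOnWith K g (Icc A B))
    (h : Per φ F g x y T) (h2 : Per φ F g u v T2) (e1 : x a = u b) (e2 : y a = v b) :
    range (fun t : ℝ => (x t, y t)) = range (fun t : ℝ => (u t, v t)) := by
  obtain ⟨R1, p1, b1⟩ := periodic_abs h.hT h.px h.contx
  obtain ⟨R2, p2, b2⟩ := periodic_abs h.hT h.py h.conty
  obtain ⟨R3, p3, b3⟩ := periodic_abs h2.hT h2.px h2.contx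
  obtain ⟨R4, p4, b4⟩ := periodic_abs h2.hT h2.py h2.conty
  obtain ⟨f1, f2⟩ := ode_unique (R := R1 + R2 + R3 + R4) (t0 := a)
    (u := fun t => u (t + (b - a))) (v := fun t => v (t + (b - a)))
    hφ hF hg h.dx h.dy
    (fun t => (h2.dx (t + (b - a))).comp_add_const t (b - a))
    (fun t => (h2.dy (t + (b - a))).comp_add_const t (b - a))
    (fun t => Icc_subset_Icc (by linarith) (by linarith) (b1 t))
    (fun t => Icc_subset_Icc (by linarith) (by linarith) (b2 t))
    (fun t => Icc_subset_Icc (by linarith) (by linarith) (b3 _))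
    (fun t => Icc_subset_Icc (by linarith) (by linarith) (b4 _))
    (by simpa using e1) (by simpa using e2)
  rw [f1, f2]
  exact (Equiv.addRight (b - a)).surjective.range_comp (fun t : ℝ => (u t, v t))


lemma G_lt_lim {g G : ℝ → ℝ} {L : EReal} (gs : ∀ x : ℝ, x ≠ 0 → 0 < x * g x)
    (Gd : ∀ x, HasDerivAt G (g x) x)
    (hL : Filter.Tendsto (fun x : ℝ => ((G x : ℝ) : EReal)) Filter.atTop (nhds L))
    {R : ℝ} (hR : 0 < R) : ((G R : ℝ) : EReal) < L := by
  have hmono := G_mono gs Gd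
  have h1 : ((G (R + 1) : ℝ) : EReal) ≤ L := by
    apply ge_of_tendsto hL
    filter_upwards [Filter.eventually_ge_atTop (R + 1)] with x hx
    rw [EReal.coe_le_coe_iff]
    exact hmono.monotoneOn (by simp; linarith) (by simp; linarith) hx
  refine lt_of_lt_of_le ?_ h1
  rw [EReal.coe_lt_coe_iff]
  exact hmono (by simp; linarith) (by simp; linarith) (by linarith)

lemma G_reach {g G : ℝ → ℝ} {L : EReal}
    (Gd : ∀ x, HasDerivAt G (g x) x) (G0 : G 0 = 0)
    (hL : Filter.Tendsto (fun x : ℝ => ((G x : ℝ) : EReal)) Filter.atTop (nhds L))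
    {M : ℝ} (hM : 0 < M) (hML : (M : EReal) < L) : ∃ X, 0 < X ∧ G X = M := by
  have h1 := hL.eventually (lt_mem_nhds hML)
  obtain ⟨x, hx1, hx2⟩ := (h1.and (Filter.eventually_gt_atTop 0)).exists
  rw [EReal.coe_lt_coe_iff] at hx1
  have hc : ContinuousOn G (Icc 0 x) := fun x _ => (Gd x).continuousAt.continuousWithinAt
  obtain ⟨X, hX, hX2⟩ := intermediate_value_Icc hx2.le hc (show M ∈ Icc (G 0) (G x) from
    ⟨by rw [G0]; exact hM.le, hx1.le⟩)
  refine ⟨X, lt_of_le_of_ne hX.1 ?_, hX2⟩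
  rintro rfl
  rw [G0] at hX2
  linarith

/-- all data of the reduction -/
structure Red (φ F g f G xp xq : ℝ → ℝ) (X Y m M : ℝ) : Prop where
  S : Sys φ F g G xp X M
  S2 : Sys (fun y => -φ (-y)) (fun x => -F (-x)) (fun x => -g (-x)) (fun x => G (-x)) xq Y M
  hf : ∀ x, HasDerivAt F (f x) x
  an : AntitoneOn (fun x : ℝ => f x / g x) (Iio 0)
  ap : AntitoneOn (fun x : ℝ => f x / g x) (Ioi 0)
  nc : ∀ ε > (0 : ℝ), ∃ x₁ x₂ : ℝ,
      x₁ ≠ 0 ∧ x₂ ≠ 0 ∧ |x₁| < ε ∧ |x₂| < ε ∧ f x₁ / g x₁ ≠ f x₂ / g x₂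
  hm : 0 < m
  hmM : m < M

lemma Red.Bder {φ F g f G xp xq : ℝ → ℝ} {X Y m M ζ : ℝ} (D : Red φ F g f G xp xq X Y m M)
    (hζ : ζ ∈ Ioo 0 M) : HasDerivAt (fun ζ => F (xp ζ)) (f (xp ζ) / g (xp ζ)) ζ :=
  D.S.Cder D.hf hζ

lemma Red.hf2 {φ F g f G xp xq : ℝ → ℝ} {X Y m M : ℝ} (D : Red φ F g f G xp xq X Y m M)
    (x : ℝ) : HasDerivAt (fun x => -(-F (-x))) (-f (-x)) x := by
  simp only [neg_neg]
  exact hasDerivAt_comp_neg' (D.hf (-x))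

lemma Red.Ader {φ F g f G xp xq : ℝ → ℝ} {X Y m M ζ : ℝ} (D : Red φ F g f G xp xq X Y m M)
    (hζ : ζ ∈ Ioo 0 M) : HasDerivAt (fun ζ => F (-xq ζ)) (f (-xq ζ) / g (-xq ζ)) ζ := by
  have := D.S2.rev.Cder D.hf2 hζ
  simpa only [neg_neg, neg_div_neg_eq] using this

lemma Red.Aconv {φ F g f G xp xq : ℝ → ℝ} {X Y m M : ℝ} (D : Red φ F g f G xp xq X Y m M) :
    ConvexOn ℝ (Icc 0 M) (fun ζ => F (-xq ζ)) := by
  have := D.S2.rev.convex D.hf2 (by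
    intro p hp q hq hpq
    simp only [neg_div_neg_eq]
    exact D.an (show -q < 0 from neg_neg_of_pos hq) (show -p < 0 from neg_neg_of_pos hp)
      (neg_le_neg hpq))
  simpa only [neg_neg] using this

lemma Red.Bconv {φ F g f G xp xq : ℝ → ℝ} {X Y m M : ℝ} (D : Red φ F g f G xp xq X Y m M) :
    ConvexOn ℝ (Icc 0 M) (fun ζ => -F (xp ζ)) :=
  D.S.rev.convex (f := fun x => -f x) (fun x => (D.hf x).neg) (by
    intro p hp q hq hpq
    simp only [neg_div]
    exact neg_le_neg (D.ap hp hq hpq))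

lemma Red.Acont {φ F g f G xp xq : ℝ → ℝ} {X Y m M : ℝ} (D : Red φ F g f G xp xq X Y m M) :
    ContinuousOn (fun ζ => F (-xq ζ)) (Icc 0 M) :=
  D.S.Fc.comp_continuousOn D.S2.xpc.neg

lemma Red.hne {φ F g f G xp xq : ℝ → ℝ} {X Y m M : ℝ} (D : Red φ F g f G xp xq X Y m M) :
    ∀ δ > 0, ∃ ζ ∈ Ioo 0 δ, F (-xq ζ) ≠ F (xp ζ) := by
  intro δ hδ
  by_contra hcon
  push Not at hcon
  have hM : 0 < M := D.hm.trans D.hmM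
  obtain ⟨r, hr0, hrδ, hrM⟩ : ∃ r, 0 < r ∧ r < δ ∧ r < M := by
    obtain ⟨r, h0, h1⟩ := exists_between (lt_min hδ hM)
    exact ⟨r, h0, h1.trans_le (min_le_left _ _), h1.trans_le (min_le_right _ _)⟩
  have hd : ∀ ζ ∈ Ioc 0 r, f (-xq ζ) / g (-xq ζ) = f (xp ζ) / g (xp ζ) := by
    intro ζ hζ
    have hζM : ζ ∈ Ioo 0 M := ⟨hζ.1, hζ.2.trans_lt hrM⟩
    refine (D.Ader hζM).unique ((D.Bder hζM).congr_of_eventuallyEq ?_)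
    filter_upwards [Ioo_mem_nhds hζ.1 (hζ.2.trans_lt hrδ)] with w hw using hcon w hw
  have hcst : ∀ ζ ∈ Ioc 0 r, f (xp ζ) / g (xp ζ) = f (xp r) / g (xp r) := by
    intro ζ hζ
    have hrr : r ∈ Ioc 0 r := ⟨hr0, le_refl _⟩
    have i1 : ζ ∈ Icc 0 M := ⟨hζ.1.le, hζ.2.trans hrM.le⟩
    have i2 : r ∈ Icc 0 M := ⟨hr0.le, hrM.le⟩
    apply le_antisymm
    · rw [← hd ζ hζ, ← hd r hrr]
      have p1 := D.S2.xp_pos (ζ := ζ) ⟨hζ.1, i1.2⟩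
      have p2 := D.S2.xp_pos (ζ := r) ⟨hr0, i2.2⟩
      exact D.an (show -xq r < 0 by linarith) (show -xq ζ < 0 by linarith)
        (neg_le_neg (D.S2.xp_mono i1 i2 hζ.2))
    · exact D.ap (D.S.xp_pos ⟨hζ.1, i1.2⟩) (D.S.xp_pos ⟨hr0, i2.2⟩) (D.S.xp_mono i1 i2 hζ.2)
  have i2 : r ∈ Icc 0 M := ⟨hr0.le, hrM.le⟩
  have p1 := D.S.xp_pos (ζ := r) ⟨hr0, i2.2⟩
  have p2 := D.S2.xp_pos (ζ := r) ⟨hr0, i2.2⟩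
  have key : ∀ x, x ≠ 0 → |x| < min (xp r) (xq r) → f x / g x = f (xp r) / g (xp r) := by
    intro x hx hxr
    rcases lt_or_gt_of_ne hx with h | h
    · rw [abs_of_neg h] at hxr
      have h1 := hxr.trans_le (min_le_right _ _)
      obtain ⟨j1, j2⟩ := D.S2.right r i2
      have k1 := D.S2.left (-x) ⟨by linarith, by linarith [j1.2]⟩
      have g1 := G_mono D.S2.gs D.S2.Gd (show (0:ℝ) ∈ Ici 0 by simp)
        (show -x ∈ Ici 0 by simp; linarith) (by linarith)
      have g2 := G_mono D.S2.gs D.S2.Gd (show -x ∈ Ici 0 by simp; linarith)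
        (show xq r ∈ Ici 0 from p2.le) h1
      rw [D.S2.G0] at g1
      rw [j2] at g2
      have hh : G (- -x) ∈ Ioc 0 r := ⟨g1, g2.le⟩
      have := hd _ hh
      rw [k1, hcst _ hh, neg_neg] at this
      exact this
    · rw [abs_of_pos h] at hxr
      have h1 := hxr.trans_le (min_le_left _ _)
      obtain ⟨j1, j2⟩ := D.S.right r i2
      have k1 := D.S.left x ⟨by linarith, by linarith [j1.2]⟩
      have g1 := G_mono D.S.gs D.S.Gd (show (0:ℝ) ∈ Ici 0 by simp) h.le h
      have g2 := G_mono D.S.gs D.S.Gd (show x ∈ Ici 0 from h.le)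
        (show xp r ∈ Ici 0 from p1.le) h1
      rw [D.S.G0] at g1
      rw [j2] at g2
      have := hcst _ ⟨g1, g2.le⟩
      rwa [k1] at this
  obtain ⟨x1, x2, n1, n2, a1, a2, hne⟩ := D.nc (min (xp r) (xq r)) (lt_min p1 p2)
  exact hne ((key x1 n1 a1).trans (key x2 n2 a2).symm)

lemma Red.arcs {φ F g f G xp xq x y : ℝ → ℝ} {X Y m M T a e : ℝ}
    (D : Red φ F g f G xp xq X Y m M) (h : Per φ F g x y T)
    (ha : ∀ s, y a ≤ y s) (he : ∀ s, y s ≤ y e) (hG : ∀ s, G (x s) ≤ m) :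
    (∃ z, Arc φ (fun ζ => F (-xq ζ)) m (y a) (y e) z) ∧
    (∃ z, Arc φ (fun ζ => F (xp ζ)) m (y a) (y e) z) := by
  constructor
  · obtain ⟨K, hK⟩ := slopeLe_of_convex D.hm D.hmM D.Aconv
    obtain ⟨z, hz⟩ := h.rot.right_arc (a := e) (e := a) (m := m) (K := K) D.S2
      (fun s => neg_le_neg (he s)) (fun s => neg_le_neg (ha s))
      (fun s _ => by simpa using hG s) D.hmM (by simpa only [neg_neg] using hK)
    have := Arc.unmirror (F := fun ζ => F (-xq ζ)) hz
    simp only [neg_neg] at this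
    exact ⟨_, this⟩
  · obtain ⟨K, hK⟩ := slopeLe_of_convex D.hm D.hmM D.Bconv
    exact h.right_arc D.S ha he (fun s _ => hG s) D.hmM hK

lemma Red.no_lt {φ F g f G xp xq x y u v : ℝ → ℝ} {X Y m M T T2 a e b c : ℝ}
    (D : Red φ F g f G xp xq X Y m M) (hφ : Monotone φ) (h : Per φ F g x y T)
    (ha : ∀ s, y a ≤ y s) (he : ∀ s, y s ≤ y e) (hG : ∀ s, G (x s) ≤ m)
    (h2 : Per φ F g u v T2)
    (hb : ∀ s, v b ≤ v s) (hc : ∀ s, v s ≤ v c) (hG2 : ∀ s, G (u s) ≤ m) : ¬ v b < y a := by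
  intro hlt
  obtain ⟨⟨zA, aA⟩, ⟨zB, aB⟩⟩ := D.arcs h ha he hG
  obtain ⟨⟨ZA, cA⟩, ⟨ZB, cB⟩⟩ := D.arcs h2 hb hc hG2
  exact scalar hφ D.S.φc D.Aconv D.Bconv D.Acont D.S.Ccont
    (by simp [D.S2.xp0, D.S.F0]) (by simp [D.S.xp0, D.S.F0]) D.hm D.hmM D.hne aA aB cA cB hlt

theorem orbits_eq (φ F g f : ℝ → ℝ)
    (hg_lip : ∀ A B : ℝ, ∃ K : NNReal, LipschitzOnWith K g (Icc A B))
    (hg_sign : ∀ x : ℝ, x ≠ 0 → 0 < x * g x)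
    (hG : ∃ L : EReal,
      Filter.Tendsto (fun x : ℝ => ((∫ s in (0 : ℝ)..x, g s : ℝ) : EReal)) Filter.atTop (nhds L) ∧
      Filter.Tendsto (fun x : ℝ => ((∫ s in (0 : ℝ)..x, g s : ℝ) : EReal)) Filter.atBot (nhds L))
    (hF0 : F 0 = 0)
    (hf : ∀ x : ℝ, HasDerivAt F (f x) x)
    (hf_cont : Continuous f)
    (an : AntitoneOn (fun x : ℝ => f x / g x) (Iio 0))
    (ap : AntitoneOn (fun x : ℝ => f x / g x) (Ioi 0))
    (nc : ∀ ε > (0 : ℝ), ∃ x₁ x₂ : ℝ,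
      x₁ ≠ 0 ∧ x₂ ≠ 0 ∧ |x₁| < ε ∧ |x₂| < ε ∧ f x₁ / g x₁ ≠ f x₂ / g x₂)
    (hφ_lip : ∀ A B : ℝ, ∃ K : NNReal, LipschitzOnWith K φ (Icc A B))
    (hφ_sign : ∀ y : ℝ, y ≠ 0 → 0 < y * φ y)
    (hφ_mono : Monotone φ) {x y u v : ℝ → ℝ} {T T2 : ℝ}
    (dx : ∀ t, HasDerivAt x (-φ (y t) - F (x t)) t) (dy : ∀ t, HasDerivAt y (g (x t)) t)
    (hn : ∃ t₁ t₂ : ℝ, (x t₁, y t₁) ≠ (x t₂, y t₂))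
    (hT : 0 < T) (px : ∀ t, x (t + T) = x t) (py : ∀ t, y (t + T) = y t)
    (du : ∀ t, HasDerivAt u (-φ (v t) - F (u t)) t) (dv : ∀ t, HasDerivAt v (g (u t)) t)
    (hn2 : ∃ t₁ t₂ : ℝ, (u t₁, v t₁) ≠ (u t₂, v t₂))
    (hT2 : 0 < T2) (pu : ∀ t, u (t + T2) = u t) (pv : ∀ t, v (t + T2) = v t) :
    range (fun t : ℝ => (x t, y t)) = range (fun t : ℝ => (u t, v t)) := by
  have gc := cont_of_lip hg_lip
  have φc := cont_of_lip hφ_lip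
  have Fc : Continuous F := continuous_iff_continuousAt.2 fun t => (hf t).continuousAt
  have hFl := lip_of_deriv hf hf_cont
  have g0 := sign_zero gc hg_sign
  have φ0 := sign_zero φc hφ_sign
  have h := per_of_sol hφ_lip hFl hg_lip φ0 hF0 g0 dx dy hn hT px py
  have h2 := per_of_sol hφ_lip hFl hg_lip φ0 hF0 g0 du dv hn2 hT2 pu pv
  obtain ⟨L, hL1, hL2⟩ := hG
  obtain ⟨G, hGdef⟩ : ∃ G : ℝ → ℝ, G = fun x => ∫ s in (0 : ℝ)..x, g s := ⟨_, rfl⟩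
  have Gd : ∀ x, HasDerivAt G (g x) x := fun x => by
    rw [hGdef]
    exact intervalIntegral.integral_hasDerivAt_right (gc.intervalIntegrable _ _)
      (gc.stronglyMeasurableAtFilter _ _) gc.continuousAt
  have G0 : G 0 = 0 := by rw [hGdef]; simp
  replace hL1 : Filter.Tendsto (fun x : ℝ => ((G x : ℝ) : EReal)) Filter.atTop (nhds L) := by
    rw [hGdef]; exact hL1
  replace hL2 : Filter.Tendsto (fun x : ℝ => ((G (-x) : ℝ) : EReal)) Filter.atTop (nhds L) := by
    rw [hGdef]; exact hL2.comp Filter.tendsto_neg_atTop_atBot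
  have gs2 : ∀ x : ℝ, x ≠ 0 → 0 < x * -g (-x) := fun x hx => by
    have := hg_sign (-x) (neg_ne_zero.2 hx)
    linarith
  have Gd2 : ∀ x, HasDerivAt (fun x => G (-x)) (-g (-x)) x := fun x =>
    hasDerivAt_comp_neg' (Gd (-x))
  obtain ⟨R1, q1, b1⟩ := periodic_abs hT px h.contx
  obtain ⟨R2, q2, b2⟩ := periodic_abs hT2 pu h2.contx
  obtain ⟨R, hR, hx, hu⟩ : ∃ R, 0 < R ∧ (∀ s, x s ∈ Icc (-R) R) ∧ (∀ s, u s ∈ Icc (-R) R) :=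
    ⟨R1 + R2, by linarith, fun s => ⟨by linarith [(b1 s).1], by linarith [(b1 s).2]⟩,
      fun s => ⟨by linarith [(b2 s).1], by linarith [(b2 s).2]⟩⟩
  have hmono := G_mono hg_sign Gd
  have hmono2 := G_mono gs2 Gd2
  have hm : 0 < max (G R) (G (-R)) := by
    have := hmono (show (0:ℝ) ∈ Ici 0 by simp) (show R ∈ Ici 0 from hR.le) hR
    rw [G0] at this
    exact lt_max_of_lt_left this
  have hGle : ∀ w ∈ Icc (-R) R, G w ≤ max (G R) (G (-R)) := by
    intro w hw
    rcases le_total 0 w with h0 | h0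
    · exact le_max_of_le_left (hmono.monotoneOn h0 hR.le hw.2)
    · have := hmono2.monotoneOn (show -w ∈ Ici 0 by simpa using h0) (show R ∈ Ici 0 from hR.le)
        (by linarith [hw.1])
      simp only [neg_neg] at this
      exact le_max_of_le_right this
  have hmL : ((max (G R) (G (-R)) : ℝ) : EReal) < L := by
    rcases max_choice (G R) (G (-R)) with h1 | h1
    · rw [h1]; exact G_lt_lim hg_sign Gd hL1 hR
    · rw [h1]; exact G_lt_lim gs2 Gd2 hL2 hR
  obtain ⟨M, hM1, hM2⟩ := EReal.lt_iff_exists_real_btwn.1 hmL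
  rw [EReal.coe_lt_coe_iff] at hM1
  have hM : 0 < M := hm.trans hM1
  obtain ⟨X, hX, GX⟩ := G_reach Gd G0 hL1 hM hM2
  obtain ⟨Y, hY, GY⟩ := G_reach Gd2 (by simpa using G0) hL2 hM hM2
  obtain ⟨xp, r1, r2, r3⟩ := Sys.exists_xp hg_sign Gd G0 hX GX
  obtain ⟨xq, l1, l2, l3⟩ := Sys.exists_xp gs2 Gd2 (by simpa using G0) hY GY
  have D : Red φ F g f G xp xq X Y (max (G R) (G (-R))) M :=
    { S := ⟨φc, hφ_sign, Fc, hF0, gc, hg_sign, Gd, G0, hX, GX, r1, r2, r3⟩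
      S2 := ⟨by fun_prop, fun y hy => by
          have := hφ_sign (-y) (neg_ne_zero.2 hy)
          linarith, by fun_prop, by simp [hF0], by fun_prop, gs2, Gd2, by simpa using G0, hY, GY,
          l1, l2, l3⟩
      hf := hf
      an := an
      ap := ap
      nc := nc
      hm := hm
      hmM := hM1 }
  obtain ⟨a, e, ha, he⟩ := periodic_bound hT py h.conty
  obtain ⟨b, c, hb, hc⟩ := periodic_bound hT2 pv h2.conty
  have n1 := D.no_lt hφ_mono h ha he (fun s => hGle _ (hx s)) h2 hb hc (fun s => hGle _ (hu s))
  have n2 := D.no_lt hφ_mono h2 hb hc (fun s => hGle _ (hu s)) h ha he (fun s => hGle _ (hx s))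
  have eq : y a = v b := le_antisymm (not_lt.1 n1) (not_lt.1 n2)
  exact same_orbit hφ_lip hFl hg_lip h h2
    ((h.half D.S ha).1.trans (h2.half D.S hb).1.symm) eq


end LCU

/-- Uniqueness theorem for limit cycles of the generalized Liénard system
`ẋ = -φ(y) - F(x)`, `ẏ = g(x)` under the classical hypotheses (1)–(3):
the system has at most one limit cycle. -/
theorem genLienard_at_most_one_limit_cycle
    (φ F g f : ℝ → ℝ)
    -- (1) hypotheses on g
    (hg_lip : ∀ A B : ℝ, ∃ K : NNReal, LipschitzOnWith K g (Set.Icc A B))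
    (hg_sign : ∀ x : ℝ, x ≠ 0 → 0 < x * g x)
    (hG : ∃ L : EReal,
      Tendsto (fun x : ℝ => ((∫ s in (0 : ℝ)..x, g s : ℝ) : EReal)) atTop (nhds L) ∧
      Tendsto (fun x : ℝ => ((∫ s in (0 : ℝ)..x, g s : ℝ) : EReal)) atBot (nhds L))
    -- (2) hypotheses on F and f = F'
    (hF_C1 : ContDiff ℝ 1 F)
    (hF0 : F 0 = 0)
    (hf : ∀ x : ℝ, HasDerivAt F (f x) x)
    (hf_cont : Continuous f)
    (hfg_anti_neg : AntitoneOn (fun x : ℝ => f x / g x) (Set.Iio 0))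
    (hfg_anti_pos : AntitoneOn (fun x : ℝ => f x / g x) (Set.Ioi 0))
    (hfg_nonconst : ∀ ε > (0 : ℝ), ∃ x₁ x₂ : ℝ,
      x₁ ≠ 0 ∧ x₂ ≠ 0 ∧ |x₁| < ε ∧ |x₂| < ε ∧ f x₁ / g x₁ ≠ f x₂ / g x₂)
    -- (3) hypotheses on φ
    (hφ_lip : ∀ A B : ℝ, ∃ K : NNReal, LipschitzOnWith K φ (Set.Icc A B))
    (hφ_sign : ∀ y : ℝ, y ≠ 0 → 0 < y * φ y)
    (hφ_mono : Monotone φ)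
    (hφ_deriv : ∃ dp dm : ℝ,
      HasDerivWithinAt φ dp (Set.Ici 0) 0 ∧ HasDerivWithinAt φ dm (Set.Iic 0) 0 ∧
      (f 0 = 0 → dp * dm ≠ 0)) :
    ∀ Γ₁ Γ₂ : Set (ℝ × ℝ),
      IsLimitCycleGenLienard φ F g Γ₁ → IsLimitCycleGenLienard φ F g Γ₂ → Γ₁ = Γ₂ := by
  rintro Γ₁ Γ₂ ⟨⟨x, y, hs, hn, ⟨T, hT, hp⟩, rfl⟩, -⟩ ⟨⟨u, v, hs2, hn2, ⟨T2, hT2, hp2⟩, rfl⟩, -⟩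
  exact LCU.orbits_eq φ F g f hg_lip hg_sign hG hF0 hf hf_cont hfg_anti_neg hfg_anti_pos
    hfg_nonconst hφ_lip hφ_sign hφ_mono (fun t => (hs t).1) (fun t => (hs t).2) hn hT
    (fun t => congrArg Prod.fst (hp t)) (fun t => congrArg Prod.snd (hp t))
    (fun t => (hs2 t).1) (fun t => (hs2 t).2) hn2 hT2
    (fun t => congrArg Prod.fst (hp2 t)) (fun t => congrArg Prod.snd (hp2 t))
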